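/- arXiv:2310.01868 — 3 statements merged into one kernel-verified Lean document; each statement's English description precedes it below -/
import Mathlib

section
/- Let p ∈ [1,2], let X be a finite-dimensional real normed space of dimension d having Rademacher type p with constant T, let n > d, and let f : {-1,1}^n → X. Then there exist a subset σ ⊆ {1,…,n} with |σ| = d, a point w ∈ {-1,1}^{σ^c}, and a bias vector 𝛂 = (α_i)_{i∈σ} ∈ [0,1]^σ such that ∫_{{-1,1}^σ} ‖f(x,w) − f(−x,−w)‖_X^p dμ_𝛂(x) ≤ 2^{2p−1}(π T)^p · Σ_{i∈σ} ∫_{{-1,1}^σ} [ ‖∂_i^{α_i} g_+(x)‖_X^p + ‖∂_i^{α_i} g_-(x)‖_X^p ] dμ_𝛂(x), where g_+(x) = f(x,w) and g_-(x) = f(−x,−w) are functions on {-1,1}^σ. -/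
open Finset

noncomputable section

/-- The real sign of a Boolean coordinate: `true ↦ 1`, `false ↦ -1`. -/
def sgn (b : Bool) : ℝ := if b then 1 else -1

/-- Hamming distance on the discrete cube `{-1,1}^n ≃ Bool^n`. -/
def hamming {n : ℕ} (x y : Fin n → Bool) : ℕ :=
  (Finset.univ.filter fun i => x i ≠ y i).card

/-- Flip the `i`-th coordinate. -/
def flipc {ι : Type*} [DecidableEq ι] (x : ι → Bool) (i : ι) : ι → Bool :=
  Function.update x i (!(x i))

/-- Negate all coordinates (the antipodal map). -/
def negc {ι : Type*} (x : ι → Bool) : ι → Bool := fun i => !(x i)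

/-- `X` has Rademacher type `p` with constant `T`. -/
def RademacherType (X : Type*) [NormedAddCommGroup X] [NormedSpace ℝ X] (p T : ℝ) : Prop :=
  ∀ (m : ℕ) (v : Fin m → X),
    (2 ^ m : ℝ)⁻¹ * ∑ x : Fin m → Bool, ‖∑ i, sgn (x i) • v i‖ ^ p ≤
      T ^ p * ∑ i, ‖v i‖ ^ p

/-- `X` has cotype `q` with constant `Cq`. -/
def CotypeC (X : Type*) [NormedAddCommGroup X] [NormedSpace ℝ X] (q Cq : ℝ) : Prop :=
  ∀ (m : ℕ) (v : Fin m → X),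
    (∑ i, ‖v i‖ ^ q) / Cq ^ q ≤
      (2 ^ m : ℝ)⁻¹ * ∑ x : Fin m → Bool, ‖∑ i, sgn (x i) • v i‖ ^ q

open scoped Classical in
/-- The weak `ℓ_p` norm of a finite real vector. -/
def weakLp {ι : Type*} [Fintype ι] (p : ℝ) (w : ι → ℝ) : ℝ :=
  sSup {z | ∃ r : ℝ, 0 ≤ r ∧
    z = r * ((Finset.univ.filter fun i => r ≤ |w i|).card : ℝ) ^ (1 / p)}

/-- Metric stable type `p` with constant `S`. -/
def MetricStableType (M : Type*) [PseudoMetricSpace M] (p S : ℝ) : Prop :=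
  ∀ (n : ℕ) (f : (Fin n → Bool) → M),
    (2 ^ n : ℝ)⁻¹ * ∑ x : Fin n → Bool, dist (f x) (f (negc x)) ^ p ≤
      S ^ p * ((2 ^ n : ℝ)⁻¹ *
        ∑ x : Fin n → Bool, weakLp p (fun i => (1 / 2) * dist (f x) (f (flipc x i))) ^ p)

/-- The product biased measure weight of a point of the cube. -/
def biasedWeight {ι : Type*} [Fintype ι] (α : ι → ℝ) (x : ι → Bool) : ℝ :=
  ∏ i, if x i then α i else 1 - α i

/-- The biased discrete partial derivative `∂_i^α`. -/
def bder {ι : Type*} [DecidableEq ι] {X : Type*} [AddCommGroup X] [Module ℝ X]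
    (α : ℝ) (i : ι) (f : (ι → Bool) → X) (x : ι → Bool) : X :=
  f x - (α • f (Function.update x i true) + (1 - α) • f (Function.update x i false))

/-- The `L_p(μ; X)` norm with respect to the weight `μ` on the cube. -/
def lpNormW {ι : Type*} [Fintype ι] [DecidableEq ι] {X : Type*} [NormedAddCommGroup X]
    (μ : (ι → Bool) → ℝ) (p : ℝ) (g : (ι → Bool) → X) : ℝ :=
  (∑ x : ι → Bool, μ x * ‖g x‖ ^ p) ^ (1 / p)

/-- The Orlicz `L_p(log L)^{p/2}(μ; X)` norm with respect to the weight `μ` on the cube. -/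
def orliczNormW {ι : Type*} [Fintype ι] [DecidableEq ι] {X : Type*} [NormedAddCommGroup X]
    (μ : (ι → Bool) → ℝ) (p : ℝ) (g : (ι → Bool) → X) : ℝ :=
  sInf {γ : ℝ | 0 < γ ∧
    ∑ x : ι → Bool, (μ x * (‖g x‖ ^ p / γ ^ p)) *
      Real.log (Real.exp 1 + ‖g x‖ ^ p / γ ^ p) ^ (p / 2) ≤ 1}

/-- The one-dimensional transition kernel `p_t^α`. -/
def ptrans (t α : ℝ) : Bool → Bool → ℝ := fun a b =>
  match a, b with
  | true, true => 1 - (1 - Real.exp (-t)) * (1 - α)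
  | true, false => (1 - Real.exp (-t)) * (1 - α)
  | false, true => (1 - Real.exp (-t)) * α
  | false, false => 1 - (1 - Real.exp (-t)) * α

/-- The matrix `η_t^α(·,·;θ)`. -/
def eta (t α θ : ℝ) : Bool → Bool → ℝ := fun a b =>
  match a, b with
  | true, true => (Real.exp (-t) - θ) / ptrans t α true true
  | true, false => (-θ) / ptrans t α false true
  | false, true => (θ - Real.exp (-t)) / ptrans t α true false
  | false, false => θ / ptrans t α false false

/-- The product transition kernel `p_t^𝛂`. -/
def pprod {n : ℕ} (t : ℝ) (α : Fin n → ℝ) (x y : Fin n → Bool) : ℝ :=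
  ∏ i, ptrans t (α i) (x i) (y i)

/-- Glue coordinates on `σ` (given by `x`) with coordinates off `σ` (given by `w`). -/
def glue {n : ℕ} (σ : Finset (Fin n)) (x : {i // i ∈ σ} → Bool) (w : Fin n → Bool) :
    Fin n → Bool := fun j => if h : j ∈ σ then x ⟨j, h⟩ else w j

/-- The low-dimensional skeleton `𝒞_d^n` of the solid cube `[-1,1]^n`. -/
def cubeSkeleton (n d : ℕ) : Set (Fin n → ℝ) :=
  {x | (∀ i, |x i| ≤ 1) ∧ n - d ≤ {i | |x i| = 1}.ncard}

/-- The `ℓ_p^d` norm on `ℝ^d`. -/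
def lpnorm (p : ℝ) {d : ℕ} (v : Fin d → ℝ) : ℝ := (∑ k, |v k| ^ p) ^ (1 / p)


/-- Indicator that the parities of the entries of a list alternate, beginning with `b`. -/
def altList (b : Bool) : List ℕ → ZMod 2
  | [] => 1
  | x :: l => (if decide (x % 2 = 1) = b then 1 else 0) * altList (!b) l

/-- Indicator that the sorted entries of a multiset alternate in parity, beginning with `b`. -/
def altMultiset (b : Bool) (s : Multiset ℕ) : ZMod 2 := altList b (s.sort (· ≤ ·))

/-- The complementary label: `2m ↔ 2m + 1`. -/
def opp (x : ℕ) : ℕ := if x % 2 = 0 then x + 1 else x - 1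

theorem add_self_zmod_two (a : ZMod 2) : a + a = 0 := CharTwo.add_self_eq_zero a

theorem altList_sum_erase (b : Bool) (l : List ℕ) (hl : l.Pairwise (· ≤ ·)) :
    (l.map fun x => altList b (l.erase x)).sum = altList b l + altList (!b) l := by
  induction l generalizing b with
  | nil => simp [altList, add_self_zmod_two]
  | cons y l ih =>
    have hl' := (List.pairwise_cons.1 hl)
    have h1 : (l.map fun x => altList b ((y :: l).erase x)) =
        l.map fun x => (if decide (y % 2 = 1) = b then 1 else 0) * altList (!b) (l.erase x) := by
      refine List.map_congr_left fun x hx => ?_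
      have : (y :: l).erase x = y :: l.erase x := by
        by_cases hxy : x = y
        · subst hxy
          rw [List.erase_cons_head]
          cases l with
          | nil => simp at hx
          | cons z l =>
            have hz : z = x := by
              rcases List.mem_cons.1 hx with h | h
              · exact h.symm
              · have h2 := (List.pairwise_cons.1 hl'.2).1 x h
                have h3 := hl'.1 z (by simp)
                omega
            subst hz
            rw [List.erase_cons_head]
        · rw [List.erase_cons_tail (by simpa using fun h => hxy h.symm)]
      rw [this, altList]
    rw [List.map_cons, List.sum_cons, List.erase_cons_head, h1, List.sum_map_mul_left,
      ih _ hl'.2, altList, altList, Bool.not_not]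
    have h2 := add_self_zmod_two (altList b l)
    cases b <;> by_cases hy : y % 2 = 1 <;> simp [hy] <;> grind

theorem altMultiset_sum_erase (b : Bool) (s : Multiset ℕ) :
    (s.map fun x => altMultiset b (s.erase x)).sum = altMultiset b s + altMultiset (!b) s := by
  have hs := Multiset.pairwise_sort s (· ≤ ·)
  rw [altMultiset, altMultiset, ← altList_sum_erase b _ hs]
  have h : s = ((s.sort (· ≤ ·) : List ℕ) : Multiset ℕ) := (Multiset.sort_eq s _).symm
  generalize s.sort (· ≤ ·) = l at hs h
  subst h
  rw [Multiset.map_coe, Multiset.sum_coe]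
  congr 1
  refine List.map_congr_left fun x _ => ?_
  rw [altMultiset, Multiset.coe_erase, Multiset.coe_sort]
  congr 1
  have := hs.sublist (List.erase_sublist (a := x))
  exact List.mergeSort_eq_self _ (by simpa using this)

theorem altList_map_opp (b : Bool) (l : List ℕ) : altList b (l.map opp) = altList (!b) l := by
  induction l generalizing b with
  | nil => rfl
  | cons x l ih =>
    rw [List.map_cons, altList, altList, ih]
    congr 1
    have h : (opp x % 2 = 1) ↔ ¬ (x % 2 = 1) := by
      unfold opp; split_ifs <;> omega
    by_cases hx : x % 2 = 1 <;> cases b <;> simp [h, hx]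

theorem altMultiset_map_opp (b : Bool) (s : Multiset ℕ)
    (hs : ∀ x ∈ s, ∀ y ∈ s, x ≠ opp y) :
    altMultiset b (s.map opp) = altMultiset (!b) s := by
  rw [altMultiset, altMultiset, ← altList_map_opp]
  congr 1
  symm
  refine Multiset.map_sort (s := s) (f := opp) (r := (· ≤ ·)) (r' := (· ≤ ·)) fun x hx y hy => ?_
  have h1 := hs x hx y hy
  have h2 := hs y hy x hx
  unfold opp at *
  split_ifs at * <;> omega

theorem altList_eq_zero {d : ℕ} (b : Bool) (l : List ℕ) (hl : l.Pairwise (· ≤ ·))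
    (hopp : ∀ x ∈ l, ∀ y ∈ l, x ≠ opp y) (hlt : ∀ x ∈ l, x < 2 * d) (m : ℕ)
    (hm : ∀ x ∈ l, 2 * m ≤ x) (hmd : m ≤ d) (hlen : d < l.length + m) : altList b l = 0 := by
  induction l generalizing b m with
  | nil => simp at hlen; omega
  | cons x l ih =>
    have hl' := List.pairwise_cons.1 hl
    have hx := hlt x (by simp)
    have hmx := hm x (by simp)
    rw [altList]
    cases l with
    | nil => simp at hlen; omega
    | cons y l =>
      by_cases hxy : x / 2 = y / 2
      · have : x = y := by
          have h1 := hopp x (by simp) y (by simp)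
          unfold opp at h1
          split_ifs at h1 <;> omega
        subst this
        rw [altList]
        by_cases hb : decide (x % 2 = 1) = b <;> simp [hb]
      · have hxy' := hl'.1 y (by simp)
        rw [ih (!b) hl'.2 (fun z hz w hw => hopp z (by simp [hz]) w (by simp [hw]))
          (fun z hz => hlt z (by simp [hz])) (x / 2 + 1), mul_zero]
        · intro z hz
          rcases List.mem_cons.1 hz with h | h
          · omega
          · have := (List.pairwise_cons.1 hl'.2).1 z h
            omega
        · omega
        · simp at hlen ⊢; omega

theorem altMultiset_eq_zero {d : ℕ} (b : Bool) (s : Multiset ℕ)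
    (hs : ∀ x ∈ s, ∀ y ∈ s, x ≠ opp y) (hlt : ∀ x ∈ s, x < 2 * d) (hcard : d < s.card) :
    altMultiset b s = 0 := by
  refine altList_eq_zero (d := d) b _ (Multiset.pairwise_sort s _) ?_ ?_ 0 (by simp) (by simp) ?_
  · simpa using hs
  · simpa using hlt
  · simpa using hcard

/-- The alternation indicator of the labels of a tuple of vertices. -/
def altTuple {k : ℕ} (b : Bool) (l : Fin k → ℕ) : ZMod 2 := altMultiset b (univ.val.map l)

theorem altTuple_boundary {k : ℕ} (b : Bool) (l : Fin (k + 1) → ℕ) :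
    ∑ j : Fin (k + 1), altTuple b (fun i => l (j.succAbove i)) = altTuple b l + altTuple (!b) l := by
  unfold altTuple
  rw [← altMultiset_sum_erase, Multiset.map_map, Finset.sum]
  congr 1
  refine Multiset.map_congr rfl fun j _ => ?_
  have : (univ : Finset (Fin (k + 1))).val.map l =
      l j ::ₘ (univ.val.map fun i => l (j.succAbove i)) := by
    rw [Fin.univ_succAbove k j]
    simp [Finset.map_val, Function.comp_def]
  rw [Function.comp_apply, this, Multiset.erase_cons_head]

theorem altTuple_comp_equiv {k : ℕ} (b : Bool) (l : Fin k → ℕ) (e : Fin k ≃ Fin k) :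
    altTuple b (l ∘ e) = altTuple b l := by
  unfold altTuple
  rw [← Multiset.map_map, ← Equiv.coe_toEmbedding, ← Finset.map_val, Finset.map_univ_equiv]

section

variable {M : ℕ}

/-- The vertices of the monotone path in the discrete cube that agrees with `u` off the range of
`q`, starts at `false` on the range of `q`, and flips the coordinates `q 0, q 1, …` in order. -/
def cubePath {k : ℕ} (q : Fin k → Fin M) (u : Fin M → Bool) (j : Fin (k + 1)) : Fin M → Bool :=
  fun x => if ∃ i : Fin k, (i : ℕ) < j ∧ q i = x then true
    else if ∃ i, q i = x then false else u x

/-- The sign pattern that alternates each time it passes an entry of `q`. -/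
def altSign {k : ℕ} (q : Fin k → Fin M) : Fin M → Bool :=
  fun x => decide (Odd (univ.filter fun i => q i < x).card)

theorem altSign_comp_equiv {k : ℕ} (q : Fin k → Fin M) (e : Fin k ≃ Fin k) :
    altSign (q ∘ e) = altSign q := by
  funext x
  unfold altSign
  congr 2
  exact Finset.card_equiv e (by simp)

theorem altSign_cons {k : ℕ} (r : Fin M) (q : Fin k → Fin M) (x : Fin M) :
    altSign (Fin.cons r q : Fin (k + 1) → Fin M) x = xor (decide (r < x)) (altSign q x) := by
  unfold altSign
  rw [Finset.card_filter, Finset.card_filter, Fin.sum_univ_succ]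
  by_cases h : r < x <;> simp [h, Nat.odd_add_one, add_comm 1, -Nat.not_odd_iff_even]

theorem altSign_snoc {k : ℕ} (r : Fin M) (q : Fin k → Fin M) (x : Fin M) :
    altSign (Fin.snoc q r : Fin (k + 1) → Fin M) x = xor (decide (r < x)) (altSign q x) := by
  unfold altSign
  rw [Finset.card_filter, Finset.card_filter, Fin.sum_univ_castSucc]
  by_cases h : r < x <;> simp [h, Nat.odd_add_one, -Nat.not_odd_iff_even]

theorem cubePath_cons_succ {k : ℕ} (r : Fin M) (q : Fin k → Fin M) (u : Fin M → Bool)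
    (hr : ∀ i, q i ≠ r) (j : Fin (k + 1)) :
    cubePath (Fin.cons r q : Fin (k + 1) → Fin M) u j.succ =
      cubePath q (Function.update u r true) j := by
  funext x
  simp only [cubePath, Fin.exists_fin_succ, Fin.cons_zero, Fin.cons_succ, Fin.val_succ,
    Fin.val_zero, Nat.zero_lt_succ, true_and, Nat.succ_lt_succ_iff]
  by_cases hx : r = x
  · subst hx
    simp [hr]
  · simp [hx, Function.update_of_ne (Ne.symm hx)]

theorem cubePath_snoc_castSucc {k : ℕ} (r : Fin M) (q : Fin k → Fin M) (u : Fin M → Bool)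
    (hr : ∀ i, q i ≠ r) (j : Fin (k + 1)) :
    cubePath (Fin.snoc q r : Fin (k + 1) → Fin M) u j.castSucc =
      cubePath q (Function.update u r false) j := by
  funext x
  have hj : ¬ (k < (j : ℕ)) := by omega
  simp only [cubePath, Fin.exists_fin_succ', Fin.snoc_last, Fin.snoc_castSucc, Fin.val_castSucc,
    Fin.val_last, hj, false_and, or_false]
  by_cases hx : r = x
  · subst hx
    simp [hr]
  · simp [hx, Function.update_of_ne (Ne.symm hx)]

theorem cubePath_comp_swap {k : ℕ} (q : Fin (k + 1) → Fin M) (u : Fin M → Bool) (a : Fin k)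
    (j : Fin (k + 2)) (hj : (j : ℕ) ≠ a + 1) :
    cubePath (q ∘ Equiv.swap a.castSucc a.succ) u j = cubePath q u j := by
  funext x
  have h1 : (∃ i : Fin (k + 1), (i : ℕ) < j ∧ (q ∘ Equiv.swap a.castSucc a.succ) i = x) ↔
      ∃ i : Fin (k + 1), (i : ℕ) < j ∧ q i = x := by
    rw [(Equiv.swap a.castSucc a.succ).surjective.exists (p := fun i => (i : ℕ) < j ∧ q i = x)]
    refine exists_congr fun i => and_congr_left' ?_
    rcases eq_or_ne i a.castSucc with rfl | h
    · rw [Equiv.swap_apply_left]; simp; omega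
    · rcases eq_or_ne i a.succ with rfl | h'
      · rw [Equiv.swap_apply_right]; simp; omega
      · rw [Equiv.swap_apply_of_ne_of_ne h h']
  have h2 : (∃ i, (q ∘ Equiv.swap a.castSucc a.succ) i = x) ↔ ∃ i, q i = x :=
    ((Equiv.swap a.castSucc a.succ).surjective.exists (p := fun i => q i = x)).symm
  simp only [cubePath, h1, h2]

theorem cubePath_not {k : ℕ} (q : Fin k → Fin M) (hq : Function.Injective q) (u : Fin M → Bool)
    (j : Fin (k + 1)) :
    cubePath q (fun x => !(u x)) j = fun x => !(cubePath (q ∘ Fin.rev) u j.rev x) := by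
  funext x
  have h2 : (∃ i, (q ∘ Fin.rev) i = x) ↔ ∃ i, q i = x :=
    (Fin.revPerm.surjective.exists (p := fun i => q i = x)).symm
  by_cases hx : ∃ i, q i = x
  · obtain ⟨i, rfl⟩ := hx
    have h1 : (∃ l : Fin k, (l : ℕ) < j ∧ q l = q i) ↔ (i : ℕ) < j := by
      constructor
      · rintro ⟨l, hl, h⟩; rwa [← hq h]
      · exact fun h => ⟨i, h, rfl⟩
    have h3 : (∃ l : Fin k, (l : ℕ) < j.rev ∧ (q ∘ Fin.rev) l = q i) ↔ ¬ (i : ℕ) < j := by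
      constructor
      · rintro ⟨l, hl, h⟩
        rw [← hq h]
        simp only [Fin.val_rev] at *
        omega
      · intro h
        refine ⟨i.rev, ?_, by simp⟩
        simp only [Fin.val_rev] at *
        omega
    simp only [cubePath, h1, h2, h3, exists_apply_eq_apply, if_true]
    by_cases h : (i : ℕ) < j <;> simp [h]
  · have h1 : ∀ (P : Fin k → Prop), ¬ ∃ l : Fin k, P l ∧ q l = x :=
      fun P ⟨l, h⟩ => hx ⟨l, h.2⟩
    have h3 : ∀ (P : Fin k → Prop), ¬ ∃ l : Fin k, P l ∧ (q ∘ Fin.rev) l = x :=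
      fun P ⟨l, h⟩ => hx ⟨l.rev, h.2⟩
    simp only [cubePath, h1, h2, h3, hx, if_false]

/-- The alternation indicator of the labels along the path `cubePath q u`. -/
def altPath (c : (Fin M → Bool) → ℕ) (b : Bool) {k : ℕ} (q : Fin k → Fin M)
    (u : Fin M → Bool) : ZMod 2 :=
  altTuple b fun j => c (cubePath q u j)

open scoped Classical in
theorem sum_altTuple_interior (c : (Fin M → Bool) → ℕ) (b : Bool) {k : ℕ} (a : Fin k) :
    ∑ q : Fin (k + 1) → Fin M, (if Function.Injective q then
      altTuple b fun i => c (cubePath q (altSign q) (a.castSucc.succ.succAbove i)) else 0) = 0 := by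
  rw [← Finset.sum_filter]
  refine Finset.sum_involution (fun q _ => q ∘ Equiv.swap a.castSucc a.succ) ?_ ?_ ?_ ?_
  · intro q _
    rw [← add_self_zmod_two (altTuple b fun i =>
      c (cubePath q (altSign q) (a.castSucc.succ.succAbove i)))]
    congr 2
    funext i
    rw [altSign_comp_equiv, cubePath_comp_swap]
    intro h
    exact Fin.succAbove_ne a.castSucc.succ i (Fin.ext (by simpa using h))
  · intro q hq _ h
    have h1 := congrFun h a.castSucc
    rw [Function.comp_apply, Equiv.swap_apply_left] at h1
    have h2 := (Finset.mem_filter.1 hq).2 h1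
    simp [Fin.ext_iff] at h2
  · intro q hq
    simpa using (Finset.mem_filter.1 hq).2
  · intro q _
    funext i
    simp

theorem sum_range_telescope (g : ℕ → ZMod 2) (m : ℕ) :
    ∑ r ∈ Finset.range m, (g r + g (r + 1)) = g 0 + g m := by
  induction m with
  | zero => simp [add_self_zmod_two]
  | succ m ih =>
    rw [Finset.sum_range_succ, ih]
    have := add_self_zmod_two (g m)
    grind

theorem cubePath_congr {k : ℕ} (q : Fin k → Fin M) {u u' : Fin M → Bool}
    (h : ∀ x, (∀ i, q i ≠ x) → u x = u' x) : cubePath q u = cubePath q u' := by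
  funext j x
  unfold cubePath
  by_cases hx : ∃ i, q i = x
  · simp [hx]
  · rw [h x (not_exists.1 hx)]

open scoped Classical in
theorem sum_altPath_extend (c : (Fin M → Bool) → ℕ) (b : Bool) {k : ℕ} (q : Fin k → Fin M)
    (w : Fin M → Bool) :
    ∑ r : Fin M, (if ∀ i, q i ≠ r then
      altPath c b q (Function.update (fun x => xor (decide (r < x)) (w x)) r true) +
      altPath c b q (Function.update (fun x => xor (decide (r < x)) (w x)) r false) else 0) =
    altPath c b q w + altPath c b q (fun x => !(w x)) := by
  let g : ℕ → ZMod 2 := fun m => altPath c b q fun x => xor (decide (m ≤ (x : ℕ))) (w x)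
  have h0 : g 0 = altPath c b q (fun x => !(w x)) := by simp [g]
  have hM : g M = altPath c b q w := by
    have h : ∀ x : Fin M, ¬ (M ≤ (x : ℕ)) := fun x => by omega
    simp [g, h]
  rw [← h0, ← hM, add_comm, ← sum_range_telescope, Finset.sum_range]
  refine Finset.sum_congr rfl fun r _ => ?_
  have key : ∀ v : Bool, (fun x : Fin M => xor (decide ((r : ℕ) + (if v = w r then 1 else 0) ≤ x))
      (w x)) = Function.update (fun x => xor (decide (r < x)) (w x)) r v := by
    intro v
    funext x
    rcases eq_or_ne x r with rfl | hx
    · by_cases hv : v = w x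
      · simp [hv]
      · simp only [hv, if_false, Function.update_self]
        cases v <;> simp_all
    · rw [Function.update_of_ne hx]
      have : (r : ℕ) ≠ x := fun h => hx (Fin.ext h.symm)
      congr 1
      simp only [decide_eq_decide, Fin.lt_def]
      split_ifs <;> omega
  split_ifs with hr
  · rw [← key, ← key]
    cases w r <;> simp [g, add_comm]
  · obtain ⟨i, hi⟩ := not_forall_not.1 hr
    have : g (r + 1) = g r := by
      simp only [g, altPath]
      rw [cubePath_congr q]
      intro x hx
      have : (r : ℕ) ≠ x := fun h => hx i (hi.trans (Fin.ext h))
      congr 1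
      simp only [decide_eq_decide]
      omega
    rw [this, add_self_zmod_two]

open scoped Classical in
/-- The number, modulo two, of paths whose labels alternate beginning with `b`. -/
def altCount (c : (Fin M → Bool) → ℕ) (b : Bool) (k : ℕ) : ZMod 2 :=
  ∑ q : Fin k → Fin M, if Function.Injective q then altPath c b q (altSign q) else 0

open scoped Classical in
theorem altCount_boundary (c : (Fin M → Bool) → ℕ) (b : Bool) (k : ℕ) :
    altCount c b (k + 1) + altCount c (!b) (k + 1) =
      ∑ q : Fin k → Fin M, if Function.Injective q then
        altPath c b q (altSign q) + altPath c b q (fun x => !(altSign q x)) else 0 := by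
  have hB : altCount c b (k + 1) + altCount c (!b) (k + 1) =
      ∑ j : Fin (k + 2), ∑ q : Fin (k + 1) → Fin M, if Function.Injective q then
        altTuple b (fun i => c (cubePath q (altSign q) (j.succAbove i))) else 0 := by
    rw [Finset.sum_comm, altCount, altCount, ← Finset.sum_add_distrib]
    refine Finset.sum_congr rfl fun q _ => ?_
    split_ifs with hq
    · rw [altPath, altPath, ← altTuple_boundary]
    · simp
  rw [hB, Fin.sum_univ_succ, Fin.sum_univ_castSucc]
  have hinj_sum : ∑ a : Fin k, ∑ q : Fin (k + 1) → Fin M, (if Function.Injective q then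
      altTuple b (fun i => c (cubePath q (altSign q) (a.castSucc.succ.succAbove i))) else 0) = 0 :=
    Finset.sum_eq_zero fun a _ => sum_altTuple_interior c b a
  rw [hinj_sum, zero_add]
  rw [← (Fin.consEquiv fun _ : Fin (k + 1) => Fin M).sum_comp,
    ← (Fin.snocEquiv fun _ : Fin (k + 1) => Fin M).sum_comp,
    Fintype.sum_prod_type_right, Fintype.sum_prod_type_right, ← Finset.sum_add_distrib]
  refine Finset.sum_congr rfl fun q _ => ?_
  by_cases hq : Function.Injective q
  · rw [if_pos hq, ← sum_altPath_extend, ← Finset.sum_add_distrib]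
    refine Finset.sum_congr rfl fun r _ => ?_
    have hmem : (∀ i, q i ≠ r) ↔ r ∉ Set.range q := by simp
    have hcons : Function.Injective (Fin.cons r q : Fin (k + 1) → Fin M) ↔ ∀ i, q i ≠ r := by
      rw [Fin.cons_injective_iff, hmem]; exact and_iff_left hq
    have hsnoc : Function.Injective (Fin.snoc q r : Fin (k + 1) → Fin M) ↔ ∀ i, q i ≠ r := by
      rw [Fin.snoc_injective_iff, hmem]; exact and_iff_right hq
    have hc' : altSign (Fin.cons r q : Fin (k + 1) → Fin M) =
      fun x => xor (decide (r < x)) (altSign q x) := funext (altSign_cons r q)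
    have hs' : altSign (Fin.snoc q r : Fin (k + 1) → Fin M) =
      fun x => xor (decide (r < x)) (altSign q x) := funext (altSign_snoc r q)
    change (if Function.Injective (Fin.cons r q : Fin (k + 1) → Fin M) then
      altTuple b (fun i => c (cubePath (Fin.cons r q : Fin (k + 1) → Fin M)
        (altSign (Fin.cons r q : Fin (k + 1) → Fin M)) (Fin.succAbove 0 i))) else 0) +
      (if Function.Injective (Fin.snoc q r : Fin (k + 1) → Fin M) then
      altTuple b (fun i => c (cubePath (Fin.snoc q r : Fin (k + 1) → Fin M)
        (altSign (Fin.snoc q r : Fin (k + 1) → Fin M))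
          (Fin.succAbove (Fin.last k).succ i))) else 0) = _
    simp only [hcons, hsnoc, hc', hs', Fin.succ_last, Fin.succAbove_zero, Fin.succAbove_last]
    split_ifs with hr
    · simp only [cubePath_cons_succ _ _ _ hr, cubePath_snoc_castSucc _ _ _ hr]
      rfl
    · simp
  · rw [if_neg hq]
    have hcons : ∀ r, ¬ Function.Injective (Fin.cons r q : Fin (k + 1) → Fin M) :=
      fun r h => hq (Fin.cons_injective_iff.1 h).2
    have hsnoc : ∀ r, ¬ Function.Injective (Fin.snoc q r : Fin (k + 1) → Fin M) :=
      fun r h => hq (Fin.snoc_injective_iff.1 h).1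
    simp [Fin.consEquiv, Fin.snocEquiv, hcons, hsnoc]

open scoped Classical in
/-- Tucker's lemma for the alternating skeleton of the discrete cube. -/
theorem exists_complementary_labels {d : ℕ} (c : (Fin M → Bool) → ℕ)
    (hlt : ∀ (q : Fin d → Fin M), Function.Injective q → ∀ j,
      c (cubePath q (altSign q) j) < 2 * d)
    (hodd : ∀ k ≤ d, ∀ (q : Fin k → Fin M), Function.Injective q → ∀ j,
      c (fun x => !(cubePath q (altSign q) j x)) = opp (c (cubePath q (altSign q) j))) :
    ∃ k ≤ d, ∃ q : Fin k → Fin M, Function.Injective q ∧ ∃ i j,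
      c (cubePath q (altSign q) i) = opp (c (cubePath q (altSign q) j)) := by
  by_contra! H
  have hflip : ∀ k ≤ d, ∀ (q : Fin k → Fin M), Function.Injective q → ∀ b,
      altPath c b (q ∘ Fin.rev) (fun x => !(altSign (q ∘ Fin.rev) x)) =
        altPath c (!b) q (altSign q) := by
    intro k hk q hq b
    have hq' : Function.Injective (q ∘ Fin.rev) := hq.comp Fin.rev_injective
    have hsgn : altSign (q ∘ Fin.rev) = altSign q := altSign_comp_equiv q Fin.revPerm
    have h1 : (fun j => c (cubePath (q ∘ Fin.rev) (fun x => !(altSign (q ∘ Fin.rev) x)) j)) =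
        (fun j => opp (c (cubePath q (altSign q) j))) ∘ Fin.revPerm := by
      funext j
      rw [cubePath_not _ hq', hsgn]
      have : (q ∘ Fin.rev) ∘ Fin.rev = q := by funext i; simp
      rw [this, hodd k hk q hq]
      rfl
    rw [altPath, h1, altTuple_comp_equiv, altTuple, altPath, altTuple, ← altMultiset_map_opp]
    · rw [Multiset.map_map]; rfl
    · intro x hx y hy
      obtain ⟨i, _, rfl⟩ := Multiset.mem_map.1 hx
      obtain ⟨j, _, rfl⟩ := Multiset.mem_map.1 hy
      exact H k hk q hq i j
  have hstep : ∀ b k, k ≤ d → altCount c b (k + 1) + altCount c (!b) (k + 1) =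
      altCount c b k + altCount c (!b) k := by
    intro b k hk
    rw [altCount_boundary]
    have h1 : altCount c (!b) k = ∑ q : Fin k → Fin M, if Function.Injective q then
        altPath c b q (fun x => !(altSign q x)) else 0 := by
      rw [altCount, ← (Equiv.arrowCongr Fin.revPerm (Equiv.refl (Fin M))).sum_comp fun q =>
        if Function.Injective q then altPath c b q (fun x => !(altSign q x)) else 0]
      refine Finset.sum_congr rfl fun q _ => ?_
      have h2 : Equiv.arrowCongr Fin.revPerm (Equiv.refl (Fin M)) q = q ∘ Fin.rev := rfl
      have h3 : Function.Injective (q ∘ Fin.rev) ↔ Function.Injective q :=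
        Function.Injective.of_comp_iff' q Fin.rev_bijective
      rw [h2]
      simp only [h3]
      split_ifs with hq
      · rw [hflip k hk q hq]
      · rfl
    rw [h1, altCount, ← Finset.sum_add_distrib]
    refine Finset.sum_congr rfl fun q _ => ?_
    split_ifs <;> simp
  have hall : ∀ k, k ≤ d → altCount c true k + altCount c false k = 1 := by
    intro k
    induction k with
    | zero =>
      intro _
      simp [altCount, altPath, altTuple, altMultiset, altList, Function.injective_of_subsingleton,
        Finset.filter_singleton]
      rcases Nat.mod_two_eq_zero_or_one (c (cubePath (default : Fin 0 → Fin M) (altSign (default : Fin 0 → Fin M)) 0)) with h | h <;>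
        simp [h]
    | succ k ih =>
      intro hk
      rw [← ih (by omega)]
      exact hstep true k (by omega)
  have hzero : ∀ b, altCount c b d = 0 := by
    intro b
    refine Finset.sum_eq_zero fun q _ => ?_
    split_ifs with hq
    · refine altMultiset_eq_zero (d := d) b _ ?_ ?_ ?_
      · intro x hx y hy
        obtain ⟨i, _, rfl⟩ := Multiset.mem_map.1 hx
        obtain ⟨j, _, rfl⟩ := Multiset.mem_map.1 hy
        exact H d le_rfl q hq i j
      · intro x hx
        obtain ⟨i, _, rfl⟩ := Multiset.mem_map.1 hx
        exact hlt q hq i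
      · simp
    · rfl
  have := hall d le_rfl
  rw [hzero, hzero] at this
  simp at this

end

/-- The proportion of `true` coordinates in each of `n` consecutive blocks of length `N`. -/
def blockAvg {n N : ℕ} (v : Fin (n * N) → Bool) (i : Fin n) : ℝ :=
  (∑ j : Fin N, if v (finProdFinEquiv (i, j)) then (1 : ℝ) else 0) / N

theorem blockAvg_not {n N : ℕ} (hN : 0 < N) (v : Fin (n * N) → Bool) :
    blockAvg (fun x => !(v x)) = 1 - blockAvg v := by
  funext i
  have hN' : (N : ℝ) ≠ 0 := by positivity
  simp only [blockAvg, Pi.sub_apply, Pi.one_apply]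
  rw [eq_sub_iff_add_eq, ← add_div, ← Finset.sum_add_distrib, div_eq_one_iff_eq hN']
  rw [Finset.sum_congr rfl (g := fun _ => (1 : ℝ))]
  · simp
  · intro j _
    by_cases h : v (finProdFinEquiv (i, j)) = true <;> simp [h]

theorem blockAvg_mem_Icc {n N : ℕ} (v : Fin (n * N) → Bool) :
    blockAvg v ∈ Set.Icc (0 : Fin n → ℝ) 1 := by
  constructor
  · intro i
    refine div_nonneg (Finset.sum_nonneg fun j _ => ?_) (Nat.cast_nonneg _)
    split_ifs <;> norm_num
  · intro i
    refine div_le_one_of_le₀ ?_ (Nat.cast_nonneg _)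
    refine (Finset.sum_le_sum (g := fun _ => (1 : ℝ)) fun j _ => ?_).trans (by simp)
    split_ifs <;> norm_num

theorem dist_blockAvg_le {n N k : ℕ} (q : Fin k → Fin (n * N)) (v v' : Fin (n * N) → Bool)
    (h : ∀ x, (∀ i, q i ≠ x) → v x = v' x) : dist (blockAvg v) (blockAvg v') ≤ k / N := by
  refine (dist_pi_le_iff (by positivity)).2 fun i => ?_
  rw [Real.dist_eq, blockAvg, blockAvg, ← sub_div, abs_div, Nat.abs_cast,
    ← Finset.sum_sub_distrib]
  refine div_le_div_of_nonneg_right ?_ (Nat.cast_nonneg _)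
  refine (Finset.abs_sum_le_sum_abs _ _).trans ?_
  have h1 : ∀ j : Fin N, |(if v (finProdFinEquiv (i, j)) then (1 : ℝ) else 0) -
      (if v' (finProdFinEquiv (i, j)) then (1 : ℝ) else 0)| ≤
      if finProdFinEquiv (i, j) ∈ univ.image q then 1 else 0 := by
    intro j
    split_ifs with _ _ hq hq _ hq hq <;> norm_num
    all_goals
      have := h _ (fun l hl => hq (Finset.mem_image.2 ⟨l, mem_univ _, hl⟩))
      simp_all
  refine (Finset.sum_le_sum fun j _ => h1 j).trans ?_
  rw [Finset.sum_boole]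
  have h2 : (univ.filter fun j : Fin N => finProdFinEquiv (i, j) ∈ univ.image q).card ≤
      (univ.image q).card := by
    refine Finset.card_le_card_of_injOn (fun j => finProdFinEquiv (i, j)) ?_ ?_
    · intro j hj
      simpa using hj
    · intro j _ j' _ hjj
      simpa using hjj
  exact_mod_cast h2.trans (Finset.card_image_le.trans (by simp))

/-- The `d`-skeleton of the cube `[0,1]^n`. -/
def unitSkeleton (n d : ℕ) : Set (Fin n → ℝ) :=
  ⋃ σ : {σ : Finset (Fin n) // σ.card = d}, ⋃ w : Fin n → Bool,
    Set.Icc 0 1 ∩ {y | ∀ i, i ∉ σ.1 → y i = if w i then 1 else 0}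

theorem isCompact_unitSkeleton (n d : ℕ) : IsCompact (unitSkeleton n d) := by
  refine isCompact_iUnion fun σ => isCompact_iUnion fun w => isCompact_Icc.inter_right ?_
  simp only [Set.ofPred_forall]
  exact isClosed_iInter fun i => isClosed_iInter fun _ =>
    isClosed_eq (continuous_apply i) continuous_const

theorem blockAvg_mem_unitSkeleton {n N k d : ℕ} (hN : 0 < N) (hk : k ≤ d) (hd : d ≤ n)
    (q : Fin k → Fin (n * N)) (j : Fin (k + 1)) :
    blockAvg (cubePath q (altSign q) j) ∈ unitSkeleton n d := by
  obtain ⟨σ, hσ, hσd⟩ := Finset.exists_superset_card_eq (s := univ.image fun l => (q l).divNat)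
    (n := d) (Finset.card_image_le.trans (by simpa using hk)) (by simpa using hd)
  have hN0 : (N : ℝ) ≠ 0 := by positivity
  refine Set.mem_iUnion.2 ⟨⟨σ, hσd⟩, Set.mem_iUnion.2
    ⟨fun i => altSign q (finProdFinEquiv (i, ⟨0, hN⟩)), blockAvg_mem_Icc _, ?_⟩⟩
  intro i hi
  have hq : ∀ l, (q l).divNat ≠ i := fun l hl =>
    hi (hσ (Finset.mem_image.2 ⟨l, mem_univ _, hl⟩))
  have hlt : ∀ l (t : Fin N), q l < finProdFinEquiv (i, t) ↔ (q l).divNat < i := by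
    intro l t
    have h1 : ((q l).divNat : ℕ) ≠ i := fun h => hq l (Fin.ext h)
    have h2 := Nat.div_add_mod (q l : ℕ) N
    have h3 := Nat.mod_lt (q l : ℕ) hN
    rw [Fin.lt_def, Fin.lt_def, finProdFinEquiv_apply_val]
    have h4 : ((q l).divNat : ℕ) = (q l : ℕ) / N := rfl
    rw [h4] at h1 ⊢
    constructor
    · intro h'
      by_contra! h
      have h5 : (i : ℕ) + 1 ≤ (q l : ℕ) / N := by omega
      have h6 := Nat.mul_le_mul_left N h5
      rw [mul_add] at h6
      have := t.2
      simp only at h'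
      omega
    · intro h
      have h6 := Nat.mul_le_mul_left N (Nat.succ_le_of_lt h)
      rw [Nat.succ_eq_add_one, mul_add] at h6
      simp only
      omega
  have hval : ∀ t : Fin N, cubePath q (altSign q) j (finProdFinEquiv (i, t)) =
      altSign q (finProdFinEquiv (i, ⟨0, hN⟩)) := by
    intro t
    have h1 : ¬ ∃ l, q l = finProdFinEquiv (i, t) := by
      rintro ⟨l, hl⟩
      refine hq l ?_
      have := congrArg Prod.fst (finProdFinEquiv.symm_apply_apply (i, t))
      rw [← hl] at this
      simpa using this
    have h2 : ¬ ∃ l : Fin k, (l : ℕ) < j ∧ q l = finProdFinEquiv (i, t) :=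
      fun ⟨l, hl⟩ => h1 ⟨l, hl.2⟩
    simp only [cubePath, h1, h2, if_false, altSign, hlt]
  simp only [blockAvg, hval, Finset.sum_const, Finset.card_univ, Fintype.card_fin]
  split_ifs <;> simp [hN0]

/-- A Borsuk–Ulam theorem for the skeleton of the cube. -/
theorem exists_zero_mem_unitSkeleton {n d : ℕ} (hd : d ≤ n) (G : (Fin n → ℝ) → Fin d → ℝ)
    (hG : Continuous G) (hodd : ∀ y, G (1 - y) = -G y) : ∃ y ∈ unitSkeleton n d, G y = 0 := by
  by_contra! H
  have hne : (unitSkeleton n d).Nonempty :=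
    ⟨_, blockAvg_mem_unitSkeleton (N := 1) one_pos (Nat.zero_le d) hd (fun i => i.elim0) 0⟩
  obtain ⟨y₀, hy₀, hmin⟩ := (isCompact_unitSkeleton n d).exists_isMinOn hne hG.norm.continuousOn
  have hε : 0 < ‖G y₀‖ := norm_pos_iff.2 (H y₀ hy₀)
  set ε := ‖G y₀‖ with hεdef
  have hd0 : Nonempty (Fin d) := by
    by_contra h
    rw [not_nonempty_iff] at h
    exact H y₀ hy₀ (Subsingleton.elim _ _)
  have hex : ∀ y ∈ unitSkeleton n d, ∃ m, ε ≤ |G y m| := by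
    intro y hy
    by_contra! h
    exact absurd (hmin hy) (not_le.2 ((pi_norm_lt_iff hε).2 h))
  obtain ⟨δ, hδ, hunif⟩ := Metric.uniformContinuousOn_iff.1
    ((isCompact_Icc (a := (0 : Fin n → ℝ)) (b := 1)).uniformContinuousOn_of_continuous
      hG.continuousOn) ε hε
  obtain ⟨N, hN⟩ := exists_nat_gt (d / δ)
  have hN0 : 0 < N := by
    have : (0 : ℝ) < N := lt_of_le_of_lt (by positivity) hN
    exact_mod_cast this
  let pick : (Fin n → ℝ) → Fin d := fun y => Classical.epsilon fun m => ε ≤ |G y m|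
  have hpick : ∀ y ∈ unitSkeleton n d, ε ≤ |G y (pick y)| :=
    fun y hy => Classical.epsilon_spec (hex y hy)
  have hpick_odd : ∀ y, pick (1 - y) = pick y := by
    intro y
    simp only [pick, hodd, Pi.neg_apply, abs_neg]
  let c : (Fin (n * N) → Bool) → ℕ := fun v =>
    2 * (pick (blockAvg v) : ℕ) + if 0 < G (blockAvg v) (pick (blockAvg v)) then 1 else 0
  obtain ⟨k, hk, q, hq, i, j, hij⟩ := exists_complementary_labels (d := d) c
    (by
      intro q _ j
      have := (pick (blockAvg (cubePath q (altSign q) j))).2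
      simp only [c]
      split_ifs <;> omega)
    (by
      intro k hk q _ j
      have hy := hpick _ (blockAvg_mem_unitSkeleton hN0 hk hd q j)
      simp only [c, blockAvg_not hN0, hpick_odd, hodd, Pi.neg_apply]
      generalize G (blockAvg (cubePath q (altSign q) j))
        (pick (blockAvg (cubePath q (altSign q) j))) = t at hy
      unfold opp
      rcases le_or_gt t 0 with ht | ht
      · have : t < 0 := by
          rcases ht.lt_or_eq with h | h
          · exact h
          · subst h; simp at hy; linarith
        simp [this, not_lt.2 ht]
      · simp [ht, not_lt.2 ht.le])
  have hi := hpick _ (blockAvg_mem_unitSkeleton hN0 hk hd q i)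
  have hj := hpick _ (blockAvg_mem_unitSkeleton hN0 hk hd q j)
  have hdist : dist (blockAvg (cubePath q (altSign q) i)) (blockAvg (cubePath q (altSign q) j))
      < δ := by
    refine (dist_blockAvg_le q _ _ ?_).trans_lt ?_
    · intro x hx
      simp [cubePath, hx]
    · rw [div_lt_iff₀ (by positivity)] at *
      have : (k : ℝ) ≤ d := by exact_mod_cast hk
      linarith
  have hGd := hunif _ (blockAvg_mem_Icc _) _ (blockAvg_mem_Icc _) hdist
  have hopp : (pick (blockAvg (cubePath q (altSign q) i)) : ℕ) =
      pick (blockAvg (cubePath q (altSign q) j)) ∧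
      ((0 < G (blockAvg (cubePath q (altSign q) i)) (pick (blockAvg (cubePath q (altSign q) i)))) ↔
      ¬ 0 < G (blockAvg (cubePath q (altSign q) j))
        (pick (blockAvg (cubePath q (altSign q) j)))) := by
    simp only [c, opp] at hij
    constructor
    · split_ifs at hij <;> omega
    · by_cases h1 : 0 < G (blockAvg (cubePath q (altSign q) i))
          (pick (blockAvg (cubePath q (altSign q) i))) <;>
        by_cases h2 : 0 < G (blockAvg (cubePath q (altSign q) j))
          (pick (blockAvg (cubePath q (altSign q) j))) <;>
        simp only [h1, h2, if_true, if_false] at hij ⊢ <;> split_ifs at hij <;> simp <;> omega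
  obtain ⟨hm, hs⟩ := hopp
  rw [Fin.ext hm] at hs hi
  have hGm := (dist_le_pi_dist _ _ (pick (blockAvg (cubePath q (altSign q) j)))).trans_lt hGd
  rw [Real.dist_eq] at hGm
  have hGm' := abs_lt.1 hGm
  rcases le_abs'.1 hi with h1 | h1 <;> rcases le_abs'.1 hj with h2 | h2
  · exact absurd (hs.2 (by linarith)) (by linarith)
  · linarith
  · linarith
  · exact absurd (by linarith) (hs.1 (by linarith))

section

variable {ι : Type*} [Fintype ι]

theorem biasedWeight_nonneg {a : ι → ℝ} (ha : ∀ i, 0 ≤ a i ∧ a i ≤ 1) (x : ι → Bool) :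
    0 ≤ biasedWeight a x := by
  refine Finset.prod_nonneg fun i _ => ?_
  split_ifs
  · exact (ha i).1
  · linarith [(ha i).2]

theorem biasedWeight_const_zero (k : ι → Bool) :
    biasedWeight (fun _ : ι => (0 : ℝ)) k = if k = fun _ => false then 1 else 0 := by
  split_ifs with h
  · simp [biasedWeight, h]
  · obtain ⟨i, hi⟩ := Function.ne_iff.1 h
    exact Finset.prod_eq_zero (Finset.mem_univ i) (by simpa using hi)

theorem biasedWeight_const_one (k : ι → Bool) :
    biasedWeight (fun _ : ι => (1 : ℝ)) k = if k = fun _ => true then 1 else 0 := by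
  split_ifs with h
  · simp [biasedWeight, h]
  · obtain ⟨i, hi⟩ := Function.ne_iff.1 h
    exact Finset.prod_eq_zero (Finset.mem_univ i) (by simpa using hi)

theorem continuous_biasedWeight (k : ι → Bool) :
    Continuous fun a : ι → ℝ => biasedWeight a k := by
  refine continuous_finsetProd _ fun i _ => ?_
  split_ifs <;> fun_prop

variable [DecidableEq ι]

theorem sum_biasedWeight_mul_apply (a : ι → ℝ) (i : ι) (h : Bool → ℝ) :
    ∑ x, biasedWeight a x * h (x i) = a i * h true + (1 - a i) * h false := by
  have h1 : ∀ x : ι → Bool, biasedWeight a x * h (x i) =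
      ∏ j, (if x j then a j else 1 - a j) * (if j = i then h (x j) else 1) := by
    intro x
    rw [Finset.prod_mul_distrib, biasedWeight]
    congr 1
    simp
  simp only [h1]
  have h2 := Finset.prod_univ_sum (fun _ : ι => (univ : Finset Bool))
    (fun j b => (if b then a j else 1 - a j) * (if j = i then h b else 1))
  rw [Fintype.piFinset_univ] at h2
  rw [← h2, Finset.prod_eq_single i]
  · simp
  · intro j _ hj
    simp [hj]
  · simp

theorem sum_biasedWeight (a : ι → ℝ) : ∑ x, biasedWeight a x = 1 := by
  have h2 := Finset.prod_univ_sum (fun _ : ι => (univ : Finset Bool))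
    (fun j b => (if b then a j else 1 - a j))
  rw [Fintype.piFinset_univ] at h2
  simp only [biasedWeight]
  rw [← h2]
  simp

/-- Take the coordinates of `x` where `k` is true, and those of `z` elsewhere. -/
def mixc (k x z : ι → Bool) : ι → Bool := fun i => if k i then x i else z i

theorem sum_sum_biasedWeight_mixc (a : ι → ℝ) (k : ι → Bool)
    (F : (ι → Bool) → (ι → Bool) → ℝ) :
    ∑ x, ∑ z, biasedWeight a x * (biasedWeight a z * F (mixc k x z) (mixc k z x)) =
      ∑ x, ∑ z, biasedWeight a x * (biasedWeight a z * F x z) := by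
  have hinv : Function.Involutive fun y : (ι → Bool) × (ι → Bool) =>
      (mixc k y.1 y.2, mixc k y.2 y.1) := by
    rintro ⟨x, z⟩
    refine Prod.ext (funext fun i => ?_) (funext fun i => ?_) <;>
      by_cases h : k i <;> simp [mixc, h]
  rw [← Fintype.sum_prod_type', ← Fintype.sum_prod_type', ← Equiv.sum_comp hinv.toPerm]
  refine Finset.sum_congr rfl fun y _ => ?_
  simp only [Function.Involutive.coe_toPerm, ← mul_assoc]
  congr 1
  · simp only [biasedWeight, ← Finset.prod_mul_distrib]
    refine Finset.prod_congr rfl fun i _ => ?_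
    by_cases h : k i <;> simp [mixc, h, mul_comm]
  · have := hinv y
    rw [Prod.ext_iff] at this
    simp only at this
    rw [this.1, this.2]

variable {X : Type*} [NormedAddCommGroup X] [NormedSpace ℝ X]

theorem norm_sum_smul_rpow_le {κ : Type*} [Fintype κ] {p : ℝ} (hp : 1 ≤ p) (w : κ → ℝ)
    (hw : ∀ i, 0 ≤ w i) (hw1 : ∑ i, w i = 1) (v : κ → X) :
    ‖∑ i, w i • v i‖ ^ p ≤ ∑ i, w i * ‖v i‖ ^ p := by
  refine le_trans (Real.rpow_le_rpow (norm_nonneg _) (norm_sum_le _ _) (by linarith)) ?_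
  simp only [norm_smul, Real.norm_eq_abs, abs_of_nonneg (hw _)]
  exact Real.rpow_arith_mean_le_arith_mean_rpow _ _ _ (fun i _ => hw i) hw1
    (fun i _ => norm_nonneg _) hp

theorem RademacherType.fintype {p T : ℝ} (h : RademacherType X p T) (v : ι → X) :
    ∑ e : ι → Bool, (2 ^ Fintype.card ι : ℝ)⁻¹ * ‖∑ i, sgn (e i) • v i‖ ^ p ≤
      T ^ p * ∑ i, ‖v i‖ ^ p := by
  have e := Fintype.equivFin ι
  have h1 := h _ (v ∘ e.symm)
  rw [← e.sum_comp, Finset.mul_sum,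
    ← (Equiv.arrowCongr e (Equiv.refl Bool)).sum_comp] at h1
  simpa [← e.sum_comp] using h1

theorem sum_biasedWeight_norm_sum_le {p T : ℝ} (hp : 1 ≤ p) (htype : RademacherType X p T)
    {u : ℝ} (hu0 : 0 ≤ u) (hu1 : u ≤ 1) (ζ : Bool → ℝ)
    (hζ : u * ζ true + (1 - u) * ζ false = 0) (v : ι → X) :
    ∑ k : ι → Bool, biasedWeight (fun _ => u) k * ‖∑ i, ζ (k i) • v i‖ ^ p ≤
      2 * u * (1 - u) * |ζ true - ζ false| ^ p * (T ^ p * ∑ i, ‖v i‖ ^ p) := by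
  set ν : (ι → Bool) → ℝ := biasedWeight (fun _ => u) with hν
  have hν0 : ∀ k, 0 ≤ ν k := biasedWeight_nonneg fun _ => ⟨hu0, hu1⟩
  have hν1 : ∑ k, ν k = 1 := sum_biasedWeight _
  have hcent : ∑ k, ν k • ∑ i, ζ (k i) • v i = 0 := by
    simp only [Finset.smul_sum, smul_smul]
    rw [Finset.sum_comm]
    refine Finset.sum_eq_zero fun i _ => ?_
    rw [← Finset.sum_smul, hν, sum_biasedWeight_mul_apply, hζ, zero_smul]
  have h1 : ∑ k, ν k * ‖∑ i, ζ (k i) • v i‖ ^ p ≤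
      ∑ k, ∑ l, ν k * (ν l * ‖∑ i, (ζ (k i) - ζ (l i)) • v i‖ ^ p) := by
    refine Finset.sum_le_sum fun k _ => ?_
    rw [← Finset.mul_sum]
    refine mul_le_mul_of_nonneg_left ?_ (hν0 k)
    refine le_trans (le_of_eq ?_) (norm_sum_smul_rpow_le hp ν hν0 hν1 _)
    congr 2
    simp only [sub_smul, Finset.sum_sub_distrib, smul_sub, hcent, ← Finset.sum_smul, hν1,
      one_smul, sub_zero]
  refine h1.trans ?_
  have h2 : ∀ e : ι → Bool, ∑ k, ∑ l, ν k * (ν l * ‖∑ i, (ζ (k i) - ζ (l i)) • v i‖ ^ p) =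
      ∑ k, ∑ l, ν k * (ν l * ‖∑ i, sgn (e i) • (ζ (k i) - ζ (l i)) • v i‖ ^ p) := by
    intro e
    rw [hν, ← sum_sum_biasedWeight_mixc _ e]
    refine Finset.sum_congr rfl fun k _ => Finset.sum_congr rfl fun l _ => ?_
    congr 4
    refine Finset.sum_congr rfl fun i _ => ?_
    by_cases h : e i
    · simp [mixc, sgn, h]
    · rw [smul_smul]
      simp [mixc, sgn, h]
  have hcard : (2 ^ Fintype.card ι : ℝ)⁻¹ * Fintype.card (ι → Bool) = 1 := by
    rw [Fintype.card_fun, Fintype.card_bool]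
    push_cast
    exact inv_mul_cancel₀ (by positivity)
  have h3 : ∑ k, ∑ l, ν k * (ν l * ‖∑ i, (ζ (k i) - ζ (l i)) • v i‖ ^ p) =
      ∑ k, ∑ l, ν k * (ν l * ∑ e : ι → Bool, (2 ^ Fintype.card ι : ℝ)⁻¹ *
        ‖∑ i, sgn (e i) • (ζ (k i) - ζ (l i)) • v i‖ ^ p) := by
    have : ∑ e : ι → Bool, (2 ^ Fintype.card ι : ℝ)⁻¹ *
        ∑ k, ∑ l, ν k * (ν l * ‖∑ i, (ζ (k i) - ζ (l i)) • v i‖ ^ p) =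
        ∑ k, ∑ l, ν k * (ν l * ‖∑ i, (ζ (k i) - ζ (l i)) • v i‖ ^ p) := by
      rw [Finset.sum_const, nsmul_eq_mul, ← mul_assoc, Finset.card_univ,
        mul_comm (Fintype.card (ι → Bool) : ℝ), hcard, one_mul]
    rw [← this, Finset.sum_congr rfl fun e _ => by rw [h2 e]]
    simp only [Finset.mul_sum]
    rw [Finset.sum_comm]
    refine Finset.sum_congr rfl fun k _ => ?_
    rw [Finset.sum_comm]
    refine Finset.sum_congr rfl fun l _ => Finset.sum_congr rfl fun e _ => ?_
    ring
  rw [h3]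
  have h4 : ∑ k, ∑ l, ν k * (ν l * ∑ e : ι → Bool, (2 ^ Fintype.card ι : ℝ)⁻¹ *
        ‖∑ i, sgn (e i) • (ζ (k i) - ζ (l i)) • v i‖ ^ p) ≤
      ∑ k, ∑ l, ν k * (ν l * (T ^ p * ∑ i, |ζ (k i) - ζ (l i)| ^ p * ‖v i‖ ^ p)) := by
    refine Finset.sum_le_sum fun k _ => Finset.sum_le_sum fun l _ => ?_
    refine mul_le_mul_of_nonneg_left (mul_le_mul_of_nonneg_left ?_ (hν0 l)) (hν0 k)
    refine (htype.fintype _).trans (le_of_eq ?_)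
    simp only [norm_smul, Real.norm_eq_abs, Real.mul_rpow (abs_nonneg _) (norm_nonneg _)]
  refine h4.trans (le_of_eq ?_)
  have h5 : ∀ i, ∑ k, ∑ l, ν k * (ν l * |ζ (k i) - ζ (l i)| ^ p) =
      2 * u * (1 - u) * |ζ true - ζ false| ^ p := by
    intro i
    simp only [← Finset.mul_sum]
    have : ∀ k : ι → Bool, ∑ l, ν l * |ζ (k i) - ζ (l i)| ^ p =
        u * |ζ (k i) - ζ true| ^ p + (1 - u) * |ζ (k i) - ζ false| ^ p := by
      intro k
      exact sum_biasedWeight_mul_apply (fun _ => u) i fun b => |ζ (k i) - ζ b| ^ p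
    simp only [this]
    rw [hν, sum_biasedWeight_mul_apply (fun _ => u) i fun b =>
      u * |ζ b - ζ true| ^ p + (1 - u) * |ζ b - ζ false| ^ p]
    rw [abs_sub_comm (ζ false)]
    simp only [sub_self, abs_zero, Real.zero_rpow (by linarith : p ≠ 0)]
    ring
  calc ∑ k, ∑ l, ν k * (ν l * (T ^ p * ∑ i, |ζ (k i) - ζ (l i)| ^ p * ‖v i‖ ^ p))
      = ∑ k, ∑ l, ∑ i, ν k * (ν l * |ζ (k i) - ζ (l i)| ^ p) * (T ^ p * ‖v i‖ ^ p) := by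
        refine Finset.sum_congr rfl fun k _ => Finset.sum_congr rfl fun l _ => ?_
        simp only [Finset.mul_sum]
        refine Finset.sum_congr rfl fun i _ => ?_
        ring
    _ = ∑ i, (∑ k, ∑ l, ν k * (ν l * |ζ (k i) - ζ (l i)| ^ p)) * (T ^ p * ‖v i‖ ^ p) := by
        rw [Finset.sum_congr rfl fun k _ => Finset.sum_comm, Finset.sum_comm]
        simp only [Finset.sum_mul]
    _ = _ := by
        simp only [h5]
        simp only [← Finset.mul_sum]

theorem sum_rpow_norm_sub_le_of_hasDerivAt {κ : Type*} [Fintype κ] {p : ℝ} (hp : 1 ≤ p)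
    {μ : κ → ℝ} (hμ : ∀ x, 0 ≤ μ x) {P P' : ℝ → κ → X} {a b B : ℝ} (hab : a < b)
    (hcont : ∀ x, Continuous fun t => P t x)
    (hder : ∀ t ∈ Set.Ioo a b, ∀ x, HasDerivAt (fun t => P t x) (P' t x) t)
    (hB : ∀ t ∈ Set.Ioo a b, ∑ x, μ x * ‖P' t x‖ ^ p ≤ B) :
    ∑ x, μ x * ‖P b x - P a x‖ ^ p ≤ (b - a) ^ p * B := by
  have hp0 : 0 < p := by linarith
  set q := ENNReal.ofReal p with hq
  have hqp : q.toReal = p := ENNReal.toReal_ofReal hp0.le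
  have : Fact (1 ≤ q) := ⟨by rw [hq]; simpa using ENNReal.ofReal_le_ofReal hp⟩
  let V : (κ → X) → PiLp q fun _ : κ => X := fun f => WithLp.toLp q fun x => μ x ^ p⁻¹ • f x
  have hnorm : ∀ f, ‖V f‖ ^ p = ∑ x, μ x * ‖f x‖ ^ p := by
    intro f
    rw [PiLp.norm_eq_sum (by rw [hqp]; exact hp0), hqp, ← Real.rpow_mul
      (Finset.sum_nonneg fun _ _ => by positivity), one_div, inv_mul_cancel₀ hp0.ne', Real.rpow_one]
    refine Finset.sum_congr rfl fun x _ => ?_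
    simp only [V, norm_smul, Real.norm_eq_abs, abs_of_nonneg (Real.rpow_nonneg (hμ x) _)]
    rw [Real.mul_rpow (Real.rpow_nonneg (hμ x) _) (norm_nonneg _), ← Real.rpow_mul (hμ x),
      inv_mul_cancel₀ hp0.ne', Real.rpow_one]
  obtain ⟨ℓ, hℓ, hℓV⟩ := exists_dual_vector'' ℝ (V (P b) - V (P a))
  let Λ : (κ → X) →L[ℝ] ℝ := ℓ.comp
    (PiLp.continuousLinearEquiv q ℝ fun _ : κ => X).symm.toContinuousLinearMap
  have hΛ : ∀ f, Λ (fun x => μ x ^ p⁻¹ • f x) = ℓ (V f) := fun f => rfl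
  have hc : ContinuousOn (fun t => Λ (fun x => μ x ^ p⁻¹ • P t x)) (Set.Icc a b) :=
    (Λ.continuous.comp (continuous_pi fun x => (hcont x).const_smul _)).continuousOn
  obtain ⟨t, ht, hslope⟩ := exists_hasDerivAt_eq_slope
    (fun t => Λ (fun x => μ x ^ p⁻¹ • P t x)) (fun t => Λ (fun x => μ x ^ p⁻¹ • P' t x)) hab hc
    fun t ht => Λ.hasFDerivAt.comp_hasDerivAt t
      (hasDerivAt_pi.2 fun x => (hder t ht x).const_smul _)
  simp only [hΛ] at hslope
  rw [← map_sub, hℓV, eq_div_iff (sub_pos.2 hab).ne'] at hslope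
  have h1 : ‖V (P b) - V (P a)‖ ≤ (b - a) * ‖V (P' t)‖ := by
    rw [show ‖V (P b) - V (P a)‖ = ℓ (V (P' t)) * (b - a) from hslope.symm, mul_comm]
    refine mul_le_mul_of_nonneg_left ?_ (sub_pos.2 hab).le
    refine (le_abs_self _).trans ((ℓ.le_opNorm _).trans ?_)
    exact mul_le_of_le_one_left (norm_nonneg _) hℓ
  have h2 : V (P b) - V (P a) = V (P b - P a) := by
    ext x
    simp [V, smul_sub]
  calc ∑ x, μ x * ‖P b x - P a x‖ ^ p = ‖V (P b - P a)‖ ^ p := by simp [hnorm]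
    _ ≤ ((b - a) * ‖V (P' t)‖) ^ p := by
      rw [← h2]
      exact Real.rpow_le_rpow (norm_nonneg _) h1 hp0.le
    _ = (b - a) ^ p * ∑ x, μ x * ‖P' t x‖ ^ p := by
      rw [Real.mul_rpow (sub_pos.2 hab).le (norm_nonneg _), hnorm]
    _ ≤ _ := mul_le_mul_of_nonneg_left (hB t ht) (Real.rpow_nonneg (sub_pos.2 hab).le _)

/-- Half the logarithmic derivative in `t` of the mass of `b` under the measure on `Bool` which
gives mass `sin t ^ 2` to `true`. -/
def angleRatio (t : ℝ) (b : Bool) : ℝ :=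
  if b then Real.cos t / Real.sin t else -(Real.sin t / Real.cos t)

theorem hasDerivAt_biasedWeight_sin_sq {t : ℝ} (hs : Real.sin t ≠ 0) (hc : Real.cos t ≠ 0)
    (k : ι → Bool) :
    HasDerivAt (fun t => biasedWeight (fun _ : ι => Real.sin t ^ 2) k)
      (biasedWeight (fun _ : ι => Real.sin t ^ 2) k * ∑ i, 2 * angleRatio t (k i)) t := by
  have h1 : ∀ i ∈ (univ : Finset ι), HasDerivAt
      (fun t => if k i then Real.sin t ^ 2 else 1 - Real.sin t ^ 2)
      ((if k i then Real.sin t ^ 2 else 1 - Real.sin t ^ 2) * (2 * angleRatio t (k i))) t := by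
    intro i _
    have hsq : HasDerivAt (fun t => Real.sin t ^ 2) (2 * Real.sin t * Real.cos t) t := by
      simpa using (Real.hasDerivAt_sin t).fun_pow 2
    by_cases h : k i
    · simp only [h, angleRatio, if_true]
      convert! hsq using 1
      field_simp
    · simp only [h, angleRatio]
      convert! hsq.const_sub 1 using 1
      rw [← Real.cos_sq']
      simp
      field_simp
  convert! HasDerivAt.fun_finsetProd h1 using 1
  rw [Finset.mul_sum]
  refine Finset.sum_congr rfl fun i _ => ?_
  rw [smul_eq_mul, ← mul_assoc (∏ j ∈ univ.erase i, _), Finset.prod_erase_mul _ _ (Finset.mem_univ i)]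
  rfl

theorem sum_biasedWeight_mul_smul_eq_zero (a : ι → ℝ) (i : ι) (h : Bool → ℝ)
    (hh : a i * h true + (1 - a i) * h false = 0) (F : (ι → Bool) → X)
    (hF : ∀ k, F (flipc k i) = F k) :
    ∑ k, (biasedWeight a k * h (k i)) • F k = 0 := by
  have hne : ∀ k : ι → Bool, flipc k i ≠ k := fun k hk => by
    simpa [flipc] using congrFun hk i
  refine Finset.sum_involution (fun k _ => flipc k i) ?_ (fun k _ _ => hne k) (by simp) ?_
  · intro k _
    rw [hF, ← add_smul]
    convert! zero_smul ℝ (F k)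
    simp only [biasedWeight]
    rw [← Finset.mul_prod_erase _ _ (Finset.mem_univ i),
      ← Finset.mul_prod_erase _ (fun j => if flipc k i j then a j else 1 - a j)
      (Finset.mem_univ i)]
    rw [Finset.prod_congr rfl (g := fun j => if k j then a j else 1 - a j)
      (s₁ := univ.erase i) (s₂ := univ.erase i) (f := fun j => if flipc k i j then a j else 1 - a j)
      fun j hj => by simp [flipc, Function.update_of_ne (Finset.ne_of_mem_erase hj)]]
    cases hk : k i <;> simp [flipc, hk] <;>
      linear_combination (∏ j ∈ univ.erase i, if k j then a j else 1 - a j) * hh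
  · intro k _
    simp [flipc]

theorem sum_angleRatio_smul_eq (a : ι → ℝ) (t : ℝ) (g : (ι → Bool) → X) (x : ι → Bool) :
    ∑ k, (biasedWeight (fun _ : ι => Real.sin t ^ 2) k * ∑ i, 2 * angleRatio t (k i)) •
        ∑ z, biasedWeight a z • g (mixc k x z) =
      ∑ k, biasedWeight (fun _ : ι => Real.sin t ^ 2) k • ∑ z, biasedWeight a z •
        ∑ i, (2 * angleRatio t (k i)) • bder (a i) i g (mixc k x z) := by
  have h1 : ∀ i, ∑ k, (biasedWeight (fun _ : ι => Real.sin t ^ 2) k * (2 * angleRatio t (k i))) •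
      ∑ z, biasedWeight a z • (g (mixc k x z) - bder (a i) i g (mixc k x z)) = 0 := by
    intro i
    refine sum_biasedWeight_mul_smul_eq_zero _ i (fun b => 2 * angleRatio t b) ?_ _ fun k => ?_
    · rw [← Real.cos_sq']
      simp only [angleRatio, if_true]
      simp
      field_simp
      ring
    · have hu : ∀ z b, Function.update (mixc (flipc k i) x z) i b =
          Function.update (mixc k x z) i b := by
        intro z b
        ext j
        by_cases hj : j = i
        · subst hj; simp
        · simp [Function.update_of_ne hj, mixc, flipc]
      simp only [bder, sub_sub_cancel, hu]
  have h2 : ∑ i, ∑ k, (biasedWeight (fun _ : ι => Real.sin t ^ 2) k * (2 * angleRatio t (k i))) •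
      ∑ z, biasedWeight a z • g (mixc k x z) =
      ∑ i, ∑ k, (biasedWeight (fun _ : ι => Real.sin t ^ 2) k * (2 * angleRatio t (k i))) •
      ∑ z, biasedWeight a z • bder (a i) i g (mixc k x z) := by
    refine Finset.sum_congr rfl fun i _ => ?_
    rw [← sub_eq_zero, ← h1 i, ← Finset.sum_sub_distrib]
    simp only [← smul_sub, ← Finset.sum_sub_distrib]
  rw [Finset.sum_comm, Finset.sum_comm (s := univ (α := ι))] at h2
  simp only [Finset.mul_sum, Finset.sum_smul, h2]
  refine Finset.sum_congr rfl fun k _ => ?_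
  simp only [Finset.smul_sum]
  rw [Finset.sum_comm]
  refine Finset.sum_congr rfl fun z _ => Finset.sum_congr rfl fun i _ => ?_
  simp only [smul_smul]
  congr 1
  ring

theorem two_mul_sin_sq_mul_angleRatio_le {p t : ℝ} (hp : p ≤ 2) (hs : 0 < Real.sin t)
    (hc : 0 < Real.cos t) :
    2 * Real.sin t ^ 2 * (1 - Real.sin t ^ 2) *
      |2 * angleRatio t true - 2 * angleRatio t false| ^ p ≤ 2 * 2 ^ p := by
  have hu : 0 < Real.sin t * Real.cos t := mul_pos hs hc
  have h1 : 2 * angleRatio t true - 2 * angleRatio t false = 2 / (Real.sin t * Real.cos t) := by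
    simp only [angleRatio, if_true]
    simp
    field_simp
    linear_combination Real.sin_sq_add_cos_sq t
  have hu1 : Real.sin t * Real.cos t ≤ 1 :=
    mul_le_one₀ (Real.sin_le_one t) hc.le (Real.cos_le_one t)
  rw [h1, ← Real.cos_sq', abs_of_pos (by positivity), Real.div_rpow zero_le_two hu.le]
  calc 2 * Real.sin t ^ 2 * Real.cos t ^ 2 * (2 ^ p / (Real.sin t * Real.cos t) ^ p)
      = 2 * 2 ^ p * ((Real.sin t * Real.cos t) ^ (2 : ℝ) / (Real.sin t * Real.cos t) ^ p) := by
        rw [Real.rpow_two]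
        ring
    _ = 2 * 2 ^ p * (Real.sin t * Real.cos t) ^ (2 - p) := by rw [Real.rpow_sub hu]
    _ ≤ 2 * 2 ^ p := mul_le_of_le_one_right (by positivity)
        (Real.rpow_le_one hu.le hu1 (by linarith))

theorem sum_norm_sum_angleRatio_rpow_le {p T : ℝ} (hp1 : 1 ≤ p) (hp2 : p ≤ 2) (hT : 0 < T)
    (htype : RademacherType X p T) {a : ι → ℝ} (ha : ∀ i, 0 ≤ a i ∧ a i ≤ 1) {t : ℝ}
    (hs : 0 < Real.sin t) (hc : 0 < Real.cos t) (D : ι → (ι → Bool) → X) :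
    ∑ x, biasedWeight a x * ‖∑ k, biasedWeight (fun _ : ι => Real.sin t ^ 2) k •
        ∑ z, biasedWeight a z • ∑ i, (2 * angleRatio t (k i)) • D i (mixc k x z)‖ ^ p ≤
      2 * (2 * T) ^ p * ∑ i, ∑ y, biasedWeight a y * ‖D i y‖ ^ p := by
  set μ := biasedWeight a with hμ
  set ν : (ι → Bool) → ℝ := biasedWeight (fun _ : ι => Real.sin t ^ 2) with hν
  have hs1 : Real.sin t ^ 2 ≤ 1 := Real.sin_sq_le_one t
  have hμ0 : ∀ x, 0 ≤ μ x := biasedWeight_nonneg ha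
  have hν0 : ∀ x, 0 ≤ ν x := biasedWeight_nonneg fun _ => ⟨sq_nonneg _, hs1⟩
  have hμ1 : ∑ x, μ x = 1 := sum_biasedWeight a
  have hν1 : ∑ x, ν x = 1 := sum_biasedWeight _
  have hζ : Real.sin t ^ 2 * (2 * angleRatio t true) +
      (1 - Real.sin t ^ 2) * (2 * angleRatio t false) = 0 := by
    rw [← Real.cos_sq']
    simp only [angleRatio, if_true]
    simp
    field_simp
    ring
  calc _ ≤ ∑ x, μ x * ∑ k, ν k * ∑ z, μ z *
        ‖∑ i, (2 * angleRatio t (k i)) • D i (mixc k x z)‖ ^ p := by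
        refine Finset.sum_le_sum fun x _ => mul_le_mul_of_nonneg_left ?_ (hμ0 x)
        refine (norm_sum_smul_rpow_le hp1 ν hν0 hν1 _).trans ?_
        refine Finset.sum_le_sum fun k _ => mul_le_mul_of_nonneg_left ?_ (hν0 k)
        exact norm_sum_smul_rpow_le hp1 μ hμ0 hμ1 _
    _ = ∑ k, ν k * ∑ x, ∑ z, μ x * (μ z *
        ‖∑ i, (2 * angleRatio t (k i)) • D i (mixc k x z)‖ ^ p) := by
        simp only [Finset.mul_sum]
        rw [Finset.sum_comm]
        refine Finset.sum_congr rfl fun k _ => Finset.sum_congr rfl fun x _ =>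
          Finset.sum_congr rfl fun z _ => ?_
        ring
    _ = ∑ k, ν k * ∑ x, μ x * ‖∑ i, (2 * angleRatio t (k i)) • D i x‖ ^ p := by
        refine Finset.sum_congr rfl fun k _ => ?_
        rw [sum_sum_biasedWeight_mixc a k
          fun x _ => ‖∑ i, (2 * angleRatio t (k i)) • D i x‖ ^ p]
        simp only [← Finset.mul_sum, ← Finset.sum_mul, ← hμ, hμ1, one_mul]
    _ = ∑ x, μ x * ∑ k, ν k * ‖∑ i, (2 * angleRatio t (k i)) • D i x‖ ^ p := by
        simp only [Finset.mul_sum]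
        rw [Finset.sum_comm]
        refine Finset.sum_congr rfl fun k _ => Finset.sum_congr rfl fun x _ => ?_
        ring
    _ ≤ ∑ x, μ x * (2 * 2 ^ p * (T ^ p * ∑ i, ‖D i x‖ ^ p)) := by
        refine Finset.sum_le_sum fun x _ => mul_le_mul_of_nonneg_left ?_ (hμ0 x)
        refine (sum_biasedWeight_norm_sum_le hp1 htype (sq_nonneg _) hs1
          (fun b => 2 * angleRatio t b) hζ _).trans ?_
        exact mul_le_mul_of_nonneg_right (two_mul_sin_sq_mul_angleRatio_le hp2 hs hc)
          (by positivity)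
    _ = _ := by
        rw [Finset.sum_comm, Real.mul_rpow zero_le_two hT.le]
        simp only [Finset.mul_sum]
        refine Finset.sum_congr rfl fun x _ => Finset.sum_congr rfl fun i _ => ?_
        ring

/-- The biased Poincaré inequality on the discrete cube. -/
theorem sum_biasedWeight_norm_sub_mean_le {p T : ℝ} (hp1 : 1 ≤ p) (hp2 : p ≤ 2) (hT : 0 < T)
    (htype : RademacherType X p T) {a : ι → ℝ} (ha : ∀ i, 0 ≤ a i ∧ a i ≤ 1)
    (g : (ι → Bool) → X) :
    ∑ x, biasedWeight a x * ‖g x - ∑ z, biasedWeight a z • g z‖ ^ p ≤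
      2 * (Real.pi * T) ^ p * ∑ i, ∑ y, biasedWeight a y * ‖bder (a i) i g y‖ ^ p := by
  let P : ℝ → (ι → Bool) → X := fun t x => ∑ k, biasedWeight (fun _ : ι => Real.sin t ^ 2) k •
    ∑ z, biasedWeight a z • g (mixc k x z)
  have hP0 : ∀ x, P 0 x = ∑ z, biasedWeight a z • g z := by
    intro x
    have h : ∀ z, mixc (fun _ => false) x z = z := fun z => funext fun i => by simp [mixc]
    simp [P, biasedWeight_const_zero, h]
  have hP1 : ∀ x, P (Real.pi / 2) x = g x := by
    intro x
    have h : ∀ z, mixc (fun _ => true) x z = x := fun z => funext fun i => by simp [mixc]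
    simp [P, biasedWeight_const_one, h, ← Finset.sum_smul, sum_biasedWeight]
  have hcont : ∀ x, Continuous fun t => P t x := by
    intro x
    refine continuous_finsetSum _ fun k _ => Continuous.smul ?_ continuous_const
    exact (continuous_biasedWeight k).comp (continuous_pi fun _ => Real.continuous_sin.pow 2)
  have key := sum_rpow_norm_sub_le_of_hasDerivAt (p := p) hp1 (biasedWeight_nonneg ha)
    (P := P) (a := 0) (b := Real.pi / 2)
    (P' := fun t x => ∑ k, biasedWeight (fun _ : ι => Real.sin t ^ 2) k •
      ∑ z, biasedWeight a z • ∑ i, (2 * angleRatio t (k i)) • bder (a i) i g (mixc k x z))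
    (B := 2 * (2 * T) ^ p * ∑ i, ∑ y, biasedWeight a y * ‖bder (a i) i g y‖ ^ p)
    (by positivity) hcont ?_ ?_
  · simp only [hP0, hP1, sub_zero] at key
    refine key.trans (le_of_eq ?_)
    have hpi : (Real.pi * T) ^ p = (Real.pi / 2) ^ p * (2 * T) ^ p := by
      rw [← Real.mul_rpow (by positivity) (by positivity)]
      congr 1
      ring
    rw [hpi]
    ring
  · intro t ht x
    have hs := Real.sin_pos_of_pos_of_lt_pi ht.1 (by linarith [ht.2, Real.pi_pos])
    have hc := Real.cos_pos_of_mem_Ioo ⟨by linarith [ht.1, Real.pi_pos], ht.2⟩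
    rw [← sum_angleRatio_smul_eq]
    exact HasDerivAt.fun_sum fun k _ =>
      (hasDerivAt_biasedWeight_sin_sq hs.ne' hc.ne' k).smul_const _
  · intro t ht
    have hs := Real.sin_pos_of_pos_of_lt_pi ht.1 (by linarith [ht.2, Real.pi_pos])
    have hc := Real.cos_pos_of_mem_Ioo ⟨by linarith [ht.1, Real.pi_pos], ht.2⟩
    exact sum_norm_sum_angleRatio_rpow_le hp1 hp2 hT htype ha hs hc fun i => bder (a i) i g

end

section

variable {X : Type*} [NormedAddCommGroup X] [NormedSpace ℝ X] {n : ℕ}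

theorem sum_biasedWeight_smul_eq_sum_glue (σ : Finset (Fin n)) (w : Fin n → Bool)
    {y : Fin n → ℝ} (hy : ∀ i, i ∉ σ → y i = if w i then 1 else 0) (h : (Fin n → Bool) → X) :
    ∑ x, biasedWeight y x • h x =
      ∑ x : {i // i ∈ σ} → Bool, biasedWeight (fun i : {i // i ∈ σ} => y i) x • h (glue σ x w) := by
  symm
  refine Fintype.sum_of_injective (fun x => glue σ x w) (fun x x' hxx => ?_) _ _
    (fun x hx => ?_) fun x => ?_
  · ext ⟨i, hi⟩
    simpa [glue, hi] using congrFun hxx i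
  · obtain ⟨i, hi, hxi⟩ : ∃ i, i ∉ σ ∧ x i ≠ w i := by
      by_contra! hcon
      refine hx ⟨fun i => x i, funext fun i => ?_⟩
      by_cases hi : i ∈ σ
      · simp [glue, hi]
      · simp [glue, hi, hcon i hi]
    have hw : biasedWeight y x = 0 := by
      refine Finset.prod_eq_zero (Finset.mem_univ i) ?_
      rw [hy i hi]
      cases hxb : x i <;> cases hwb : w i <;> simp_all
    rw [hw, zero_smul]
  · congr 1
    simp only [biasedWeight]
    rw [← Finset.prod_subset (Finset.subset_univ σ) fun i _ hi => ?_, ← Finset.prod_coe_sort σ]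
    · exact Finset.prod_congr rfl fun i _ => by simp [glue]
    · rw [hy i hi]
      cases hwb : w i <;> simp [glue, hi, hwb]

theorem negc_glue (σ : Finset (Fin n)) (x : {i // i ∈ σ} → Bool) (w : Fin n → Bool) :
    negc (glue σ x w) = glue σ (fun i => !(x i)) (fun j => !(w j)) := by
  funext i
  by_cases hi : i ∈ σ <;> simp [negc, glue, hi]

theorem sum_biasedWeight_one_sub_smul (y : Fin n → ℝ) (f : (Fin n → Bool) → X) :
    ∑ x, biasedWeight (1 - y) x • (f x - f (negc x)) =
      -∑ x, biasedWeight y x • (f x - f (negc x)) := by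
  have hinv : Function.Involutive (negc : (Fin n → Bool) → Fin n → Bool) := fun x => by
    funext i
    simp [negc]
  rw [← Equiv.sum_comp hinv.toPerm, ← Finset.sum_neg_distrib]
  refine Finset.sum_congr rfl fun x _ => ?_
  have hw : biasedWeight (1 - y) (negc x) = biasedWeight y x := by
    refine Finset.prod_congr rfl fun i _ => ?_
    cases hx : x i <;> simp [negc, hx]
  rw [Function.Involutive.coe_toPerm, hw, hinv x, ← smul_neg, neg_sub]

/-- Some biased measure on a `d`-dimensional subcube gives mean zero to `x ↦ f x - f (-x)`. -/
theorem exists_glue_sum_eq [FiniteDimensional ℝ X] (hn : Module.finrank ℝ X ≤ n)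
    (f : (Fin n → Bool) → X) :
    ∃ (σ : Finset (Fin n)) (w : Fin n → Bool) (a : {i // i ∈ σ} → ℝ),
      σ.card = Module.finrank ℝ X ∧ (∀ i, 0 ≤ a i ∧ a i ≤ 1) ∧
      ∑ x, biasedWeight a x • (f (glue σ x w) - f (negc (glue σ x w))) = 0 := by
  let L : X ≃L[ℝ] (Fin (Module.finrank ℝ X) → ℝ) := ContinuousLinearEquiv.ofFinrankEq (by simp)
  obtain ⟨y, hy, hy0⟩ := exists_zero_mem_unitSkeleton hn
    (fun y => L (∑ x, biasedWeight y x • (f x - f (negc x))))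
    (L.continuous.comp (continuous_finsetSum _ fun x _ =>
      (continuous_biasedWeight x).smul continuous_const))
    (fun y => by rw [sum_biasedWeight_one_sub_smul, map_neg])
  rw [unitSkeleton] at hy
  simp only [Set.mem_iUnion] at hy
  obtain ⟨⟨σ, hσ⟩, w, hy1, hy2⟩ := hy
  refine ⟨σ, w, fun i => y i, hσ, fun i => ⟨hy1.1 i, hy1.2 i⟩, ?_⟩
  rw [← sum_biasedWeight_smul_eq_sum_glue σ w hy2 fun x => f x - f (negc x)]
  exact (map_eq_zero_iff L L.injective).1 hy0

end

/-- The restricted biased Poincaré inequality: for any function on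
`{-1,1}^n` with values in a `d`-dimensional normed space of Rademacher type `p`
(`d < n`), there are a `d`-element set of coordinates `σ`, a point `w` on the
complementary coordinates and a bias vector `𝛂 ∈ [0,1]^σ` such that the antipodal
subcube Poincaré inequality holds with constant `2^{2p-1}(πT)^p`. Here
`g_+(x) = f(x,w)` and `g_-(x) = f(-x,-w)`. -/
theorem stmt14 (p : ℝ) (hp1 : 1 ≤ p) (hp2 : p ≤ 2)
    (X : Type) [NormedAddCommGroup X] [NormedSpace ℝ X] [FiniteDimensional ℝ X]
    (T : ℝ) (hT : 0 < T) (htype : RademacherType X p T)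
    (n : ℕ) (hn : Module.finrank ℝ X < n)
    (f : (Fin n → Bool) → X) :
    ∃ (σ : Finset (Fin n)) (w : Fin n → Bool) (a : {i // i ∈ σ} → ℝ),
      σ.card = Module.finrank ℝ X ∧ (∀ i, 0 ≤ a i ∧ a i ≤ 1) ∧
      ∑ x : {i // i ∈ σ} → Bool, biasedWeight a x *
          ‖f (glue σ x w) - f (glue σ (fun i => !(x i)) (fun j => !(w j)))‖ ^ p ≤
        (2 : ℝ) ^ (2 * p - 1) * (Real.pi * T) ^ p *
          ∑ i : {i // i ∈ σ}, ∑ x : {i // i ∈ σ} → Bool, biasedWeight a x *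
            (‖bder (a i) i (fun z => f (glue σ z w)) x‖ ^ p +
             ‖bder (a i) i (fun z => f (glue σ (fun j => !(z j)) (fun j => !(w j)))) x‖ ^ p) := by
  obtain ⟨σ, w, a, hσ, ha, hmean⟩ := exists_glue_sum_eq hn.le f
  refine ⟨σ, w, a, hσ, ha, ?_⟩
  simp only [negc_glue, smul_sub, Finset.sum_sub_distrib, sub_eq_zero] at hmean
  set gp : ({i // i ∈ σ} → Bool) → X := fun x => f (glue σ x w)
  set gm : ({i // i ∈ σ} → Bool) → X := fun x => f (glue σ (fun i => !(x i)) (fun j => !(w j)))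
  have hμ := biasedWeight_nonneg ha
  have hp := sum_biasedWeight_norm_sub_mean_le hp1 hp2 hT htype ha gp
  have hm := sum_biasedWeight_norm_sub_mean_le hp1 hp2 hT htype ha gm
  rw [← hmean] at hm
  set c : X := ∑ x, biasedWeight a x • gp x
  set Rp := ∑ i, ∑ x, biasedWeight a x * ‖bder (a i) i gp x‖ ^ p
  set Rm := ∑ i, ∑ x, biasedWeight a x * ‖bder (a i) i gm x‖ ^ p
  have hR : 0 ≤ Rp + Rm := add_nonneg
    (Finset.sum_nonneg fun i _ => Finset.sum_nonneg fun x _ => mul_nonneg (hμ x) (by positivity))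
    (Finset.sum_nonneg fun i _ => Finset.sum_nonneg fun x _ => mul_nonneg (hμ x) (by positivity))
  calc ∑ x, biasedWeight a x * ‖gp x - gm x‖ ^ p
      ≤ ∑ x, biasedWeight a x * (2 ^ (p - 1) * (‖gp x - c‖ ^ p + ‖gm x - c‖ ^ p)) := by
        refine Finset.sum_le_sum fun x _ => mul_le_mul_of_nonneg_left ?_ (hμ x)
        refine le_trans (Real.rpow_le_rpow (norm_nonneg _) ?_ (by linarith))
          (by exact_mod_cast NNReal.rpow_add_le_mul_rpow_add_rpow ‖gp x - c‖₊ ‖gm x - c‖₊ hp1)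
        simpa using norm_sub_le (gp x - c) (gm x - c)
    _ = 2 ^ (p - 1) * (∑ x, biasedWeight a x * ‖gp x - c‖ ^ p +
          ∑ x, biasedWeight a x * ‖gm x - c‖ ^ p) := by
        rw [← Finset.sum_add_distrib, Finset.mul_sum]
        exact Finset.sum_congr rfl fun x _ => by ring
    _ ≤ 2 ^ (p - 1) * (2 * (Real.pi * T) ^ p * Rp + 2 * (Real.pi * T) ^ p * Rm) :=
        mul_le_mul_of_nonneg_left (add_le_add hp hm) (by positivity)
    _ = 2 ^ p * ((Real.pi * T) ^ p * (Rp + Rm)) := by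
        rw [Real.rpow_sub_one two_ne_zero]
        ring
    _ ≤ 2 ^ (2 * p - 1) * ((Real.pi * T) ^ p * (Rp + Rm)) :=
        mul_le_mul_of_nonneg_right
          (Real.rpow_le_rpow_of_exponent_le one_le_two (by linarith)) (by positivity)
    _ = _ := by
        simp only [Rp, Rm, mul_add, Finset.sum_add_distrib, mul_assoc]
end
end

section
/- There exists a universal constant C > 0 with the following property. Let p ∈ [1,2], let X be a finite-dimensional real normed space of dimension d having Rademacher type p with constant T, let n > d, and let f : {-1,1}^n → X. Then min_{x ∈ {-1,1}^n} ‖f(x) − f(−x)‖_X ≤ C · T · d^{1/p} · max_{x,y ∈ {-1,1}^n, ρ(x,y)=1} ‖f(x) − f(y)‖_X. -/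
open Finset

noncomputable section

section DiscreteBorsukUlam

variable {S : Type*} [AddCommGroup S]

/-- Sum of `Ψ (c + ∑ κ N_i) [N_1, …, N_m]` over all lists `[N_1, …, N_m]` with entries below `L`. -/
def cutSum (κ : ℕ → S) (L : ℕ) : ℕ → S → (S → List ℕ → ZMod 2) → ZMod 2
  | 0, c, Ψ => Ψ c []
  | m + 1, c, Ψ => ∑ N ∈ range L, cutSum κ L m (c + κ N) fun v l => Ψ v (N :: l)

/-- The product of the increments of the functions in the list along the path that starts at `v`
and whose steps are `κ (N + 1) - κ N`, for `N` running through the list. -/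
def pathProd (κ : ℕ → S) : List (S → ZMod 2) → S → List ℕ → ZMod 2
  | [], _, _ => 1
  | _ :: _, _, [] => 0
  | a :: as, v, N :: l =>
    (a v + a (v + (κ (N + 1) - κ N))) * pathProd κ as (v + (κ (N + 1) - κ N)) l

lemma cutSum_add (κ : ℕ → S) (L m : ℕ) (c : S) (Ψ Φ : S → List ℕ → ZMod 2) :
    cutSum κ L m c (fun v l => Ψ v l + Φ v l) = cutSum κ L m c Ψ + cutSum κ L m c Φ := by
  induction m generalizing c Ψ Φ with
  | zero => rfl
  | succ m ih => simp only [cutSum, ih, sum_add_distrib]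

lemma cutSum_zero (κ : ℕ → S) (L m : ℕ) (c : S) :
    cutSum κ L m c (fun _ _ => 0) = 0 := by
  induction m generalizing c with
  | zero => rfl
  | succ m ih => simp only [cutSum, ih, sum_const_zero]

lemma cutSum_add_left (κ : ℕ → S) (L m : ℕ) (c w : S) (Ψ : S → List ℕ → ZMod 2) :
    cutSum κ L m (c + w) Ψ = cutSum κ L m c fun v l => Ψ (v + w) l := by
  induction m generalizing c Ψ with
  | zero => rfl
  | succ m ih =>
    simp only [cutSum]
    refine sum_congr rfl fun N _ => ?_
    rw [add_right_comm, ih]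

lemma exists_of_cutSum_ne_zero (κ : ℕ → S) (L m : ℕ) (c : S) (Ψ : S → List ℕ → ZMod 2)
    (h : cutSum κ L m c Ψ ≠ 0) :
    ∃ l : List ℕ, l.length = m ∧ (∀ N ∈ l, N < L) ∧ Ψ (c + (l.map κ).sum) l ≠ 0 := by
  induction m generalizing c Ψ with
  | zero => exact ⟨[], rfl, by simp, by simpa [cutSum] using h⟩
  | succ m ih =>
    obtain ⟨N, hN, h⟩ := exists_ne_zero_of_sum_ne_zero h
    obtain ⟨l, rfl, hl, h⟩ := ih _ _ h
    refine ⟨N :: l, rfl, ?_, ?_⟩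
    · simpa using ⟨by simpa using hN, hl⟩
    · simpa [add_assoc] using h

lemma sum_sum_eq_zero_of_symm (L : ℕ) (t : ℕ → ℕ → ZMod 2) (hs : ∀ i j, t i j = t j i)
    (h0 : ∀ i, t i i = 0) : ∑ i ∈ range L, ∑ j ∈ range L, t i j = 0 := by
  rw [← sum_product']
  refine sum_involution (fun x _ => (x.2, x.1)) ?_ ?_ ?_ ?_
  · rintro ⟨i, j⟩ -
    simp only [hs j i, CharTwo.add_self_eq_zero]
  · rintro ⟨i, j⟩ - h heq
    simp only [Prod.mk.injEq] at heq
    obtain rfl := heq.1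
    exact h (h0 _)
  · rintro ⟨i, j⟩ h
    simp only [mem_product] at h ⊢
    exact h.symm
  · rintro ⟨i, j⟩ -
    rfl

lemma sum_cutSum_pathProd_step (κ : ℕ → S) (L : ℕ)
    (hκ : ∀ N, (κ (N + 1) - κ N) + (κ (N + 1) - κ N) = 0)
    (as : List (S → ZMod 2)) (φ : S → ZMod 2) (c : S) :
    ∑ N ∈ range L, cutSum κ L as.length (c + κ N)
        (fun v l => φ v * pathProd κ as (v + (κ (N + 1) - κ N)) l) =
      ∑ N ∈ range L, cutSum κ L as.length (c + κ N) (fun v l => φ v * pathProd κ as v l) := by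
  induction as generalizing φ c with
  | nil => rfl
  | cons a as ih =>
    set e : ℕ → S := fun N => κ (N + 1) - κ N with he
    have key : ∀ N, ∑ N' ∈ range L, cutSum κ L as.length (c + κ N + κ N')
          (fun v l => φ v * (a v + a (v + e N)) * pathProd κ as (v + e N + e N') l) =
        ∑ N' ∈ range L, cutSum κ L as.length (c + κ N + κ N')
          (fun v l => φ v * (a v + a (v + e N)) * pathProd κ as (v + e N) l) := by
      intro N
      have := ih (fun v => φ (v - e N) * (a (v - e N) + a v)) (c + κ N + e N)
      simp only [add_right_comm _ (e N), cutSum_add_left _ _ _ _ (e N),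
        add_sub_cancel_right] at this
      simpa only [add_right_comm _ (e N)] using this
    have hsplit : ∀ N N', cutSum κ L as.length (c + κ N + κ N')
          (fun v l => φ v * ((a (v + e N) + a (v + e N + e N')) *
            pathProd κ as (v + e N + e N') l)) =
        cutSum κ L as.length (c + κ N + κ N')
          (fun v l => φ v * (a v + a (v + e N + e N')) * pathProd κ as (v + e N + e N') l) +
        cutSum κ L as.length (c + κ N + κ N')
          (fun v l => φ v * (a v + a (v + e N)) * pathProd κ as (v + e N + e N') l) := by
      intro N N'
      rw [← cutSum_add]
      congr 1
      funext v l
      linear_combination (-φ v * a v * pathProd κ as (v + e N + e N') l) *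
        (CharTwo.two_eq_zero : (2 : ZMod 2) = 0)
    simp only [List.length_cons, cutSum, pathProd]
    change ∑ N ∈ range L, ∑ N' ∈ range L, cutSum κ L as.length (c + κ N + κ N')
          (fun v l => φ v * ((a (v + e N) + a (v + e N + e N')) *
            pathProd κ as (v + e N + e N') l)) =
        ∑ N ∈ range L, ∑ N' ∈ range L, cutSum κ L as.length (c + κ N + κ N')
          (fun v l => φ v * ((a v + a (v + e N')) * pathProd κ as (v + e N') l))
    simp only [hsplit, sum_add_distrib, key]
    rw [sum_sum_eq_zero_of_symm, zero_add, sum_comm]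
    · simp only [add_right_comm c, mul_assoc]
    · intro i j
      simp only [add_right_comm _ _ (κ j), add_right_comm _ _ (e j)]
    · intro i
      have h2 : ∀ v, v + e i + e i = v := fun v => by rw [add_assoc, hκ, add_zero]
      simp only [h2, CharTwo.add_self_eq_zero, mul_zero, zero_mul, cutSum_zero]

lemma pathProd_add (κ : ℕ → S) (ν : S) (as : List (S → ZMod 2))
    (has : ∀ a ∈ as, ∀ v, a (v + ν) = a v + 1) (v : S) (l : List ℕ) :
    pathProd κ as (v + ν) l = pathProd κ as v l := by
  induction as generalizing v l with
  | nil => rfl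
  | cons a as ih =>
    cases l with
    | nil => rfl
    | cons N l =>
      have ha := has a (by simp)
      simp only [pathProd, add_right_comm _ ν, ha]
      rw [ih fun b hb => has b (by simp [hb])]
      linear_combination (pathProd κ as (v + (κ (N + 1) - κ N)) l) *
        (CharTwo.two_eq_zero : (2 : ZMod 2) = 0)

theorem cutSum_pathProd (κ : ℕ → S) (L : ℕ)
    (hκ : ∀ N, (κ (N + 1) - κ N) + (κ (N + 1) - κ N) = 0)
    (as : List (S → ZMod 2)) (has : ∀ a ∈ as, ∀ v, a (v + (κ 0 - κ L)) = a v + 1) (c : S) :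
    cutSum κ L as.length c (pathProd κ as) = 1 := by
  induction as generalizing c with
  | nil => rfl
  | cons a as ih =>
    have has' : ∀ b ∈ as, ∀ v, b (v + (κ 0 - κ L)) = b v + 1 := fun b hb => has b (by simp [hb])
    set E : ℕ → ZMod 2 := fun N =>
      cutSum κ L as.length (c + κ N) (fun v l => a v * pathProd κ as v l) with hE
    have h2 : ∀ N, cutSum κ L as.length (c + κ N) (fun v l =>
        a (v + (κ (N + 1) - κ N)) * pathProd κ as (v + (κ (N + 1) - κ N)) l) = E (N + 1) := by
      intro N
      rw [← cutSum_add_left κ L _ _ (κ (N + 1) - κ N) (fun v l => a v * pathProd κ as v l), hE]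
      simp only [add_assoc, add_sub_cancel]
    have h0 : E 0 = cutSum κ L as.length (c + κ L)
        (fun v l => (a v + 1) * pathProd κ as v l) := by
      have : c + κ 0 = c + κ L + (κ 0 - κ L) := by abel
      simp only [hE]
      rw [this, cutSum_add_left]
      simp only [has a (by simp), pathProd_add κ _ as has']
    simp only [List.length_cons, cutSum, pathProd, add_mul, cutSum_add, sum_add_distrib,
      sum_cutSum_pathProd_step κ L hκ, h2]
    change ∑ N ∈ range L, E N + ∑ N ∈ range L, E (N + 1) = 1
    have htel := sum_range_sub E L
    rw [sum_sub_distrib] at htel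
    rw [add_comm, ← CharTwo.sub_eq_add, htel, CharTwo.sub_eq_add, h0, hE, ← cutSum_add]
    have : (fun (v : S) (l : List ℕ) => a v * pathProd κ as v l + (a v + 1) * pathProd κ as v l) =
        pathProd κ as := by
      funext v l
      linear_combination (a v * pathProd κ as v l) * (CharTwo.two_eq_zero : (2 : ZMod 2) = 0)
    rw [this, ih has']

lemma exists_step_of_pathProd_ne_zero (κ : ℕ → S) (L : ℕ) (as : List (S → ZMod 2)) (v : S)
    (l : List ℕ) (hl : ∀ N ∈ l, N < L) (h : pathProd κ as v l ≠ 0) (a : S → ZMod 2) (ha : a ∈ as) :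
    ∃ w, ∃ N < L, a w ≠ a (w + (κ (N + 1) - κ N)) ∧
      ∀ (F : S → ℝ) (ε : ℝ), 0 ≤ ε →
        (∀ u, ∀ N < L, |F (u + (κ (N + 1) - κ N)) - F u| ≤ ε) → |F w - F v| ≤ as.length * ε := by
  induction as generalizing v l with
  | nil => simp at ha
  | cons b as ih =>
    cases l with
    | nil => simp [pathProd] at h
    | cons N l =>
      simp only [pathProd] at h
      have hN : N < L := hl N (by simp)
      rcases List.mem_cons.1 ha with rfl | ha
      · refine ⟨v, N, hN, fun heq => h ?_, fun F ε hε _ => ?_⟩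
        · rw [← heq, CharTwo.add_self_eq_zero, zero_mul]
        · rw [sub_self, abs_zero]; positivity
      · obtain ⟨w, N', hN', hw, hF⟩ :=
          ih _ l (fun M hM => hl M (by simp [hM])) (right_ne_zero_of_mul h) ha
        refine ⟨w, N', hN', hw, fun F ε hε hstep => ?_⟩
        have h1 := hF F ε hε hstep
        have h2 := hstep v N hN
        calc |F w - F v| ≤ _ := abs_sub_le _ (F (v + (κ (N + 1) - κ N))) _
          _ ≤ as.length * ε + ε := add_le_add h1 h2
          _ = _ := by push_cast [List.length_cons]; ring

/-- A discrete Borsuk–Ulam theorem: an odd slowly varying map to `ℝ^d` almost vanishes at a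
configuration of `d` cuts. -/
theorem exists_cuts_abs_le (κ : ℕ → S) (L : ℕ)
    (hκ : ∀ N, (κ (N + 1) - κ N) + (κ (N + 1) - κ N) = 0)
    (τ : S → ZMod 2) (hτ : ∀ v, τ (v + (κ 0 - κ L)) = τ v + 1)
    {d : ℕ} (F : Fin d → S → ℝ) (hF : ∀ i v, F i (v + (κ 0 - κ L)) = -F i v)
    (ε : ℝ) (hε : 0 ≤ ε)
    (hstep : ∀ i u, ∀ N < L, |F i (u + (κ (N + 1) - κ N)) - F i u| ≤ ε) :
    ∃ l : List ℕ, l.length = d ∧ ∀ i, |F i (l.map κ).sum| ≤ (d + 1) * ε := by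
  set a : Fin d → S → ZMod 2 := fun i v =>
    if 0 < F i v then 1 else if F i v < 0 then 0 else τ v with ha
  have hodd : ∀ i v, a i (v + (κ 0 - κ L)) = a i v + 1 := by
    intro i v
    simp only [ha, hF, hτ, neg_pos, neg_lt_zero]
    rcases lt_trichotomy (F i v) 0 with h | h | h
    · simp [h, h.not_gt]
    · simp [h]
    · simp [h, h.not_gt]
      decide
  have hsum := cutSum_pathProd κ L hκ (List.ofFn a) (by
    intro b hb
    obtain ⟨i, rfl⟩ := (List.mem_ofFn).1 hb
    exact hodd i) 0
  obtain ⟨l, hlen, hl, hne⟩ := exists_of_cutSum_ne_zero κ L _ 0 _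
    (by rw [hsum]; exact one_ne_zero)
  rw [List.length_ofFn] at hlen
  rw [zero_add] at hne
  refine ⟨l, hlen, fun i => ?_⟩
  obtain ⟨w, N, hN, hw, hclose⟩ := exists_step_of_pathProd_ne_zero κ L _ _ l hl hne (a i)
    (List.mem_ofFn.2 ⟨i, rfl⟩)
  have h1 := hclose (F i) ε hε (hstep i)
  rw [List.length_ofFn] at h1
  have h2 := abs_le.1 (hstep i w N hN)
  have h3 : |F i w| ≤ ε := by
    by_contra! hlt
    apply hw
    rcases lt_abs.1 hlt with h | h
    · have h4 : 0 < F i w := by linarith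
      have h5 : 0 < F i (w + (κ (N + 1) - κ N)) := by linarith [h2.1]
      simp only [ha, h4, h5, if_true]
    · have h4 : F i w < 0 := by linarith
      have h5 : F i (w + (κ (N + 1) - κ N)) < 0 := by linarith [h2.2]
      simp only [ha, h4, h5, h4.not_gt, h5.not_gt, if_true, if_false]
  have h4 := abs_le.1 h1
  have h5 := abs_le.1 h3
  rw [abs_le]
  constructor <;> nlinarith

end DiscreteBorsukUlam

section RademacherEnflo

lemma RademacherType.expect_norm_le {X : Type*} [NormedAddCommGroup X] [NormedSpace ℝ X] {p T : ℝ}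
    (hX : RademacherType X p T) (hp : 1 ≤ p) (hT : 0 < T) {ι : Type*} [Fintype ι] [DecidableEq ι]
    (v : ι → X) :
    (2 ^ Fintype.card ι : ℝ)⁻¹ * ∑ x : ι → Bool, ‖∑ i, sgn (x i) • v i‖ ≤
      T * (∑ i, ‖v i‖ ^ p) ^ (1 / p) := by
  have hp0 : 0 < p := by linarith
  have e := Fintype.equivFin ι
  have h := hX _ (v ∘ e.symm)
  have h1 : ∑ i, ‖(v ∘ e.symm) i‖ ^ p = ∑ i, ‖v i‖ ^ p :=
    Equiv.sum_comp e.symm fun i => ‖v i‖ ^ p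
  have h2 : ∑ x : Fin (Fintype.card ι) → Bool, ‖∑ i, sgn (x i) • (v ∘ e.symm) i‖ ^ p =
      ∑ x : ι → Bool, ‖∑ i, sgn (x i) • v i‖ ^ p := by
    refine Fintype.sum_equiv (Equiv.arrowCongr e.symm (Equiv.refl _)) _ _ fun x => ?_
    congr 2
    refine Fintype.sum_equiv e.symm _ _ fun i => ?_
    simp
  rw [h1, h2] at h
  have hJ := Real.arith_mean_le_rpow_mean univ (fun _ : ι → Bool => (2 ^ Fintype.card ι : ℝ)⁻¹)
    (fun x => ‖∑ i, sgn (x i) • v i‖) (fun _ _ => by positivity) (by simp)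
    (fun _ _ => norm_nonneg _) hp
  rw [← mul_sum, ← mul_sum] at hJ
  refine hJ.trans ((Real.rpow_le_rpow (by positivity) h (by positivity)).trans_eq ?_)
  rw [Real.mul_rpow (by positivity) (by positivity), ← Real.rpow_mul hT.le,
    mul_one_div_cancel hp0.ne', Real.rpow_one]

/-- Exchange the coordinates of a pair of points where `ε` is `false`. -/
def swapCoords {ι Ω : Type*} (ε : ι → Bool) : Equiv.Perm ((ι → Ω) × (ι → Ω)) :=
  Function.Involutive.toPerm
    (fun x => (fun i => if ε i then x.1 i else x.2 i, fun i => if ε i then x.2 i else x.1 i)) (by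
      intro x
      ext i <;> by_cases h : ε i <;> simp [h])

lemma swapCoords_fst {ι Ω : Type*} (ε : ι → Bool) (x : (ι → Ω) × (ι → Ω)) (i : ι) :
    (swapCoords ε x).1 i = if ε i then x.1 i else x.2 i := rfl

lemma swapCoords_snd {ι Ω : Type*} (ε : ι → Bool) (x : (ι → Ω) × (ι → Ω)) (i : ι) :
    (swapCoords ε x).2 i = if ε i then x.2 i else x.1 i := rfl

section ProductWeights

variable {ι Ω : Type*} [Fintype ι] [DecidableEq ι] [Fintype Ω]

lemma sum_prod_weight_eq_one (u : ι → Ω → ℝ) (hu : ∀ i, ∑ a, u i a = 1) :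
    ∑ x : ι → Ω, ∏ k, u k (x k) = 1 := by
  rw [← Fintype.prod_sum]
  simp [hu]

lemma sum_prod_weight_mul (u : ι → Ω → ℝ) (hu : ∀ i, ∑ a, u i a = 1) (i : ι) (ψ : Ω → ℝ) :
    ∑ x : ι → Ω, (∏ k, u k (x k)) * ψ (x i) = ∑ a, u i a * ψ a := by
  have h : ∀ x : ι → Ω, (∏ k, u k (x k)) * ψ (x i) =
      ∏ k, u k (x k) * (if k = i then ψ (x k) else 1) := by
    intro x
    rw [prod_mul_distrib, prod_ite_eq' univ i]
    simp
  simp only [h]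
  rw [← Fintype.prod_sum (fun k a => u k a * if k = i then ψ a else 1),
    ← mul_prod_erase univ _ (mem_univ i)]
  rw [prod_eq_one, mul_one]
  · simp
  · intro k hk
    simp [(mem_erase.1 hk).1, hu]

variable {X : Type*} [NormedAddCommGroup X] [NormedSpace ℝ X]

lemma sum_prod_weight_norm_le_sub (u : ι → Ω → ℝ) (hu0 : ∀ i a, 0 ≤ u i a)
    (hu : ∀ i, ∑ a, u i a = 1) (z : ι → Ω → ℝ) (hz : ∀ i, ∑ a, u i a * z i a = 0) (v : ι → X) :
    ∑ x : ι → Ω, (∏ k, u k (x k)) * ‖∑ i, z i (x i) • v i‖ ≤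
      ∑ x : (ι → Ω) × (ι → Ω), ((∏ k, u k (x.1 k)) * ∏ k, u k (x.2 k)) *
        ‖∑ i, (z i (x.1 i) - z i (x.2 i)) • v i‖ := by
  rw [Fintype.sum_prod_type]
  refine sum_le_sum fun x _ => ?_
  simp only [mul_assoc, ← mul_sum]
  refine mul_le_mul_of_nonneg_left ?_ (prod_nonneg fun k _ => hu0 _ _)
  have h : ∑ i, z i (x i) • v i =
      ∑ y : ι → Ω, (∏ k, u k (y k)) • ∑ i, (z i (x i) - z i (y i)) • v i := by
    simp only [sub_smul, sum_sub_distrib, smul_sub]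
    rw [← sum_smul, sum_prod_weight_eq_one u hu, one_smul]
    simp only [smul_sum, smul_smul]
    rw [sum_comm]
    simp only [← sum_smul, sum_prod_weight_mul u hu, hz]
    simp
  rw [h]
  refine (norm_sum_le _ _).trans (le_of_eq (sum_congr rfl fun y _ => ?_))
  rw [norm_smul, Real.norm_of_nonneg (prod_nonneg fun k _ => hu0 _ _)]

lemma sum_prod_weight_sub_swap (u : ι → Ω → ℝ) (z : ι → Ω → ℝ) (v : ι → X) (ε : ι → Bool) :
    ∑ x : (ι → Ω) × (ι → Ω), ((∏ k, u k (x.1 k)) * ∏ k, u k (x.2 k)) *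
        ‖∑ i, (z i (x.1 i) - z i (x.2 i)) • v i‖ =
      ∑ x : (ι → Ω) × (ι → Ω), ((∏ k, u k (x.1 k)) * ∏ k, u k (x.2 k)) *
        ‖∑ i, sgn (ε i) • (z i (x.1 i) - z i (x.2 i)) • v i‖ := by
  rw [← Equiv.sum_comp (swapCoords ε)]
  refine sum_congr rfl fun x _ => ?_
  simp only [← prod_mul_distrib]
  congr 1
  · refine prod_congr rfl fun i _ => ?_
    by_cases h : ε i <;> simp [swapCoords_fst, swapCoords_snd, h, mul_comm]
  · congr 1
    refine sum_congr rfl fun i _ => ?_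
    by_cases h : ε i
    · simp [swapCoords_fst, swapCoords_snd, h, sgn]
    · simp only [swapCoords_fst, swapCoords_snd, h, sgn, Bool.false_eq_true, if_false]
      module

/-- Rademacher type `p` controls sums of independent centered real random variables. -/
lemma RademacherType.sum_prod_weight_norm_le {p T : ℝ}
    (hX : RademacherType X p T) (hp : 1 ≤ p) (hT : 0 < T)
    (u : ι → Ω → ℝ) (hu0 : ∀ i a, 0 ≤ u i a)
    (hu : ∀ i, ∑ a, u i a = 1) (z : ι → Ω → ℝ) (hz : ∀ i, ∑ a, u i a * z i a = 0) (v : ι → X) :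
    ∑ x : ι → Ω, (∏ k, u k (x k)) * ‖∑ i, z i (x i) • v i‖ ≤
      T * (∑ i, (∑ a, ∑ b, u i a * u i b * |z i a - z i b| ^ p) * ‖v i‖ ^ p) ^ (1 / p) := by
  classical
  refine (sum_prod_weight_norm_le_sub u hu0 hu z hz v).trans ?_
  set W : (ι → Ω) × (ι → Ω) → ℝ := fun x => (∏ k, u k (x.1 k)) * ∏ k, u k (x.2 k) with hW
  have hW0 : ∀ x, 0 ≤ W x := fun x =>
    mul_nonneg (prod_nonneg fun k _ => hu0 _ _) (prod_nonneg fun k _ => hu0 _ _)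
  have hW1 : ∑ x, W x = 1 := by
    simp only [hW]
    rw [Fintype.sum_prod_type]
    simp [← mul_sum, sum_prod_weight_eq_one u hu]
  have hcard : (2 ^ Fintype.card ι : ℝ)⁻¹ * ∑ _ε : ι → Bool, (1 : ℝ) = 1 := by simp
  calc ∑ x, W x * ‖∑ i, (z i (x.1 i) - z i (x.2 i)) • v i‖
      = (2 ^ Fintype.card ι : ℝ)⁻¹ * ∑ ε : ι → Bool, ∑ x, W x *
          ‖∑ i, sgn (ε i) • (z i (x.1 i) - z i (x.2 i)) • v i‖ := by
        simp only [hW, ← sum_prod_weight_sub_swap]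
        simp
    _ = ∑ x, W x * ((2 ^ Fintype.card ι : ℝ)⁻¹ * ∑ ε : ι → Bool,
          ‖∑ i, sgn (ε i) • (z i (x.1 i) - z i (x.2 i)) • v i‖) := by
        rw [sum_comm, mul_sum]
        refine sum_congr rfl fun x _ => ?_
        rw [← mul_sum]
        ring
    _ ≤ ∑ x, W x * (T * (∑ i, ‖(z i (x.1 i) - z i (x.2 i)) • v i‖ ^ p) ^ (1 / p)) :=
        sum_le_sum fun x _ => mul_le_mul_of_nonneg_left (hX.expect_norm_le hp hT _) (hW0 x)
    _ = T * ∑ x, W x * (∑ i, ‖(z i (x.1 i) - z i (x.2 i)) • v i‖ ^ p) ^ (1 / p) := by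
        rw [mul_sum]
        exact sum_congr rfl fun x _ => by ring
    _ ≤ T * (∑ x, W x * ∑ i, ‖(z i (x.1 i) - z i (x.2 i)) • v i‖ ^ p) ^ (1 / p) := by
        refine mul_le_mul_of_nonneg_left ?_ hT.le
        refine (Real.arith_mean_le_rpow_mean univ W _ (fun x _ => hW0 x) hW1
          (fun x _ => by positivity) hp).trans_eq ?_
        congr 1
        refine sum_congr rfl fun x _ => ?_
        rw [← Real.rpow_mul (by positivity), one_div_mul_cancel (by linarith), Real.rpow_one]
    _ = _ := by
        congr 2
        simp only [mul_sum]
        rw [sum_comm]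
        refine sum_congr rfl fun i _ => ?_
        simp only [norm_smul, Real.norm_eq_abs, Real.mul_rpow (abs_nonneg _) (norm_nonneg _),
          ← mul_assoc, ← sum_mul]
        congr 1
        simp only [hW]
        rw [Fintype.sum_prod_type]
        simp only [mul_assoc, ← mul_sum]
        have h (x : ι → Ω) := sum_prod_weight_mul u hu i fun b => |z i (x i) - z i b| ^ p
        simp only [h]
        rw [sum_prod_weight_mul u hu i fun a => ∑ b, u i b * |z i a - z i b| ^ p]

end ProductWeights

end RademacherEnflo

section NoiseSemigroup

lemma sgn_mul_self (b : Bool) : sgn b * sgn b = 1 := by cases b <;> norm_num [sgn]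

lemma sgn_not (b : Bool) : sgn (!b) = -sgn b := by cases b <;> norm_num [sgn]

lemma abs_sgn (b : Bool) : |sgn b| = 1 := by cases b <;> norm_num [sgn]

lemma flipc_flipc {ι : Type*} [DecidableEq ι] (x : ι → Bool) (i : ι) :
    flipc (flipc x i) i = x := by
  simp [flipc]

/-- The permutation of the cube flipping the `i`-th coordinate. -/
def flipPerm {ι : Type*} [DecidableEq ι] (i : ι) : Equiv.Perm (ι → Bool) :=
  Function.Involutive.toPerm (fun x => flipc x i) fun x => flipc_flipc x i

lemma flipPerm_apply {ι : Type*} [DecidableEq ι] (i : ι) (x : ι → Bool) :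
    flipPerm i x = flipc x i := rfl

variable {ι : Type*} [Fintype ι]

/-- The probability that `q`-correlated uniform points of the cube move from `x` to `y`. -/
def noiseKernel (q : ℝ) (x y : ι → Bool) : ℝ := ∏ i, (1 + q * (sgn (x i) * sgn (y i))) / 2

lemma noiseKernel_nonneg {q : ℝ} (hq : |q| ≤ 1) (x y : ι → Bool) : 0 ≤ noiseKernel q x y := by
  refine prod_nonneg fun i _ => ?_
  have h : |q * (sgn (x i) * sgn (y i))| ≤ 1 := by simpa [abs_mul, abs_sgn] using hq
  linarith [(abs_le.1 h).1]

lemma noiseKernel_one (x y : ι → Bool) : noiseKernel 1 x y = if y = x then 1 else 0 := by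
  rw [noiseKernel]
  split_ifs with h
  · subst h
    refine prod_eq_one fun i _ => ?_
    rw [sgn_mul_self]
    norm_num
  · obtain ⟨i, hi⟩ := Function.ne_iff.1 h
    refine prod_eq_zero (mem_univ i) ?_
    have : y i = !(x i) := by revert hi; cases x i <;> cases y i <;> simp
    rw [this, sgn_not]
    linear_combination -sgn_mul_self (x i) / 2

lemma noiseKernel_zero (x y : ι → Bool) : noiseKernel 0 x y = (2 ^ Fintype.card ι : ℝ)⁻¹ := by
  simp [noiseKernel]

variable [DecidableEq ι]

/-- The contribution of the coordinate `i` to the derivative of `noiseKernel` in `q`. -/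
def noiseKernelDeriv (q : ℝ) (x y : ι → Bool) (i : ι) : ℝ :=
  (∏ k ∈ univ.erase i, (1 + q * (sgn (x k) * sgn (y k))) / 2) * (sgn (x i) * sgn (y i) / 2)

lemma hasDerivAt_noiseKernel (q : ℝ) (x y : ι → Bool) :
    HasDerivAt (fun q => noiseKernel q x y) (∑ i, noiseKernelDeriv q x y i) q := by
  simp only [noiseKernel, noiseKernelDeriv, ← smul_eq_mul (_ : ℝ) (sgn _ * sgn _ / 2)]
  refine HasDerivAt.fun_finsetProd fun i _ => ?_
  simpa using (((hasDerivAt_id q).mul_const (sgn (x i) * sgn (y i))).const_add 1).div_const 2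

lemma continuous_noiseKernelDeriv (x y : ι → Bool) (i : ι) :
    Continuous fun q => noiseKernelDeriv q x y i := by
  unfold noiseKernelDeriv
  fun_prop

lemma one_sub_sq_mul_noiseKernelDeriv (q : ℝ) (x y : ι → Bool) (i : ι) :
    (1 - q ^ 2) * noiseKernelDeriv q x y i =
      noiseKernel q x y * (sgn (x i) * sgn (y i) - q) := by
  rw [noiseKernel, noiseKernelDeriv, ← mul_prod_erase univ _ (mem_univ i)]
  have h : (sgn (x i) * sgn (y i)) * (sgn (x i) * sgn (y i)) = 1 := by
    linear_combination (sgn (y i) * sgn (y i)) * sgn_mul_self (x i) + sgn_mul_self (y i)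
  linear_combination (-q / 2 *
    ∏ k ∈ univ.erase i, (1 + q * (sgn (x k) * sgn (y k))) / 2) * h

lemma noiseKernelDeriv_flipc (q : ℝ) (x y : ι → Bool) (i : ι) :
    noiseKernelDeriv q x (flipc y i) i = -noiseKernelDeriv q x y i := by
  have h : ∀ k ∈ univ.erase i, (1 + q * (sgn (x k) * sgn (flipc y i k))) / 2 =
      (1 + q * (sgn (x k) * sgn (y k))) / 2 := by
    intro k hk
    rw [flipc, Function.update_of_ne (mem_erase.1 hk).1]
  rw [noiseKernelDeriv, noiseKernelDeriv, prod_congr rfl h, flipc, Function.update_self, sgn_not]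
  ring

variable {X : Type*} [NormedAddCommGroup X] [NormedSpace ℝ X]

lemma sum_noiseKernelDeriv_smul (q : ℝ) (x : ι → Bool) (i : ι) (f : (ι → Bool) → X) :
    ∑ y, noiseKernelDeriv q x y i • f y =
      ∑ y, noiseKernelDeriv q x y i • (1 / 2 : ℝ) • (f y - f (flipc y i)) := by
  have h : ∑ y, noiseKernelDeriv q x y i • f (flipc y i) =
      -∑ y, noiseKernelDeriv q x y i • f y := by
    rw [← Equiv.sum_comp (flipPerm i)]
    simp [flipPerm_apply, flipc_flipc, noiseKernelDeriv_flipc]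
  simp only [smul_sub, sum_sub_distrib, smul_comm _ (1 / 2 : ℝ), ← smul_sum, h]
  module

lemma RademacherType.sum_noiseKernel_norm_le {p T : ℝ} (hX : RademacherType X p T) (hp : 1 ≤ p)
    (hp2 : p ≤ 2) (hT : 0 < T) {q s : ℝ} (hs : 0 ≤ s) (hqs : q ^ 2 + s ^ 2 = 1)
    (y : ι → Bool) (v : ι → X) :
    ∑ x, noiseKernel q x y * ‖∑ i, (sgn (x i) * sgn (y i) - q) • v i‖ ≤
      2 * T * s * (∑ i, ‖v i‖ ^ p) ^ (1 / p) := by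
  have hp0 : 0 < p := by linarith
  have hq : |q| ≤ 1 := abs_le_one_iff_mul_self_le_one.2 (by nlinarith)
  have hs1 : s ≤ 1 := by nlinarith
  have hy := fun i => sgn_mul_self (y i)
  have h := hX.sum_prod_weight_norm_le hp hT
    (fun i a => (1 + q * (sgn a * sgn (y i))) / 2) ?_ ?_ (fun i a => sgn a * sgn (y i) - q) ?_ v
  · refine h.trans ?_
    have hc : ∀ i, ∑ a : Bool, ∑ b : Bool, (1 + q * (sgn a * sgn (y i))) / 2 *
        ((1 + q * (sgn b * sgn (y i))) / 2) *
          |sgn a * sgn (y i) - q - (sgn b * sgn (y i) - q)| ^ p ≤ (2 * s) ^ p := by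
      intro i
      have h1 : |sgn true * sgn (y i) - q - (sgn false * sgn (y i) - q)| = 2 := by
        cases y i <;> norm_num [sgn]
      have h2 : |sgn false * sgn (y i) - q - (sgn true * sgn (y i) - q)| = 2 := by
        cases y i <;> norm_num [sgn]
      have h3 : s ^ 2 ≤ s ^ p := by
        rw [← Real.rpow_two]
        exact Real.rpow_le_rpow_of_exponent_ge' hs hs1 hp0.le hp2
      have h4 : (0 : ℝ) < 2 ^ p := by positivity
      simp only [Fintype.sum_bool, h1, h2, sub_self, abs_zero, Real.zero_rpow hp0.ne', mul_zero,
        add_zero, zero_add]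
      rw [Real.mul_rpow zero_le_two hs]
      have h5 : (1 + q * (sgn true * sgn (y i))) / 2 * ((1 + q * (sgn false * sgn (y i))) / 2) =
          s ^ 2 / 4 := by
        simp only [sgn, if_true, Bool.false_eq_true, if_false]
        have := hy i
        simp only [sgn] at this
        linear_combination (-q ^ 2 / 4) * this - hqs / 4
      rw [h5, mul_comm ((1 + q * (sgn false * sgn (y i))) / 2), h5]
      nlinarith [sq_nonneg s]
    calc _ ≤ T * (∑ i, (2 * s) ^ p * ‖v i‖ ^ p) ^ (1 / p) := by
          refine mul_le_mul_of_nonneg_left (Real.rpow_le_rpow ?_ ?_ (by positivity)) hT.le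
          · refine sum_nonneg fun i _ => mul_nonneg (sum_nonneg fun a _ => sum_nonneg fun b _ => ?_)
              (by positivity)
            have ha : |q * (sgn a * sgn (y i))| ≤ 1 := by simpa [abs_mul, abs_sgn] using hq
            have hb : |q * (sgn b * sgn (y i))| ≤ 1 := by simpa [abs_mul, abs_sgn] using hq
            have ha' : 0 ≤ (1 + q * (sgn a * sgn (y i))) / 2 := by linarith [(abs_le.1 ha).1]
            have hb' : 0 ≤ (1 + q * (sgn b * sgn (y i))) / 2 := by linarith [(abs_le.1 hb).1]
            positivity
          · exact sum_le_sum fun i _ => mul_le_mul_of_nonneg_right (hc i) (by positivity)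
      _ = _ := by
          rw [← mul_sum, Real.mul_rpow (by positivity) (by positivity),
            ← Real.rpow_mul (by positivity), mul_one_div_cancel hp0.ne', Real.rpow_one]
          ring
  · intro i a
    have ha : |q * (sgn a * sgn (y i))| ≤ 1 := by simpa [abs_mul, abs_sgn] using hq
    linarith [(abs_le.1 ha).1]
  · intro i
    simp only [Fintype.sum_bool, sgn, if_true, Bool.false_eq_true, if_false]
    ring
  · intro i
    have := hy i
    simp only [Fintype.sum_bool, sgn, if_true, Bool.false_eq_true, if_false] at this ⊢
    linear_combination q * this

/-- The norm of the derivative of the noise operator, summed over the cube. -/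
lemma RademacherType.sum_norm_noise_deriv_le {p T : ℝ} (hX : RademacherType X p T) (hp : 1 ≤ p)
    (hp2 : p ≤ 2) (hT : 0 < T) {q s : ℝ} (hs : 0 ≤ s) (hqs : q ^ 2 + s ^ 2 = 1)
    (f : (ι → Bool) → X) :
    ∑ x, ‖s • ∑ y, (∑ i, noiseKernelDeriv q x y i) • f y‖ ≤
      2 * T * ∑ y, (∑ i, ‖(1 / 2 : ℝ) • (f y - f (flipc y i))‖ ^ p) ^ (1 / p) := by
  rcases hs.eq_or_lt with rfl | hs0
  · simp only [zero_smul, norm_zero, sum_const_zero]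
    positivity
  have hq : |q| ≤ 1 := abs_le_one_iff_mul_self_le_one.2 (by nlinarith)
  have hsq : 1 - q ^ 2 = s * s := by linarith
  have h : ∀ x, s • (s • ∑ y, (∑ i, noiseKernelDeriv q x y i) • f y) =
      ∑ y, noiseKernel q x y • ∑ i, (sgn (x i) * sgn (y i) - q) •
        (1 / 2 : ℝ) • (f y - f (flipc y i)) := by
    intro x
    simp only [sum_smul]
    rw [sum_comm]
    simp only [sum_noiseKernelDeriv_smul q x _ f]
    rw [sum_comm, smul_smul, smul_sum]
    refine sum_congr rfl fun y _ => ?_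
    simp only [smul_sum, smul_smul _ _ ((1 / 2 : ℝ) • _), ← hsq, one_sub_sq_mul_noiseKernelDeriv]
  refine le_of_mul_le_mul_left ?_ hs0
  calc s * ∑ x, ‖s • ∑ y, (∑ i, noiseKernelDeriv q x y i) • f y‖
      = ∑ x, ‖∑ y, noiseKernel q x y • ∑ i, (sgn (x i) * sgn (y i) - q) •
          (1 / 2 : ℝ) • (f y - f (flipc y i))‖ := by
        rw [mul_sum]
        refine sum_congr rfl fun x _ => ?_
        rw [← h, norm_smul s (s • _), Real.norm_of_nonneg hs]
    _ ≤ ∑ x, ∑ y, noiseKernel q x y * ‖∑ i, (sgn (x i) * sgn (y i) - q) •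
          (1 / 2 : ℝ) • (f y - f (flipc y i))‖ := by
        refine sum_le_sum fun x _ => (norm_sum_le _ _).trans_eq (sum_congr rfl fun y _ => ?_)
        rw [norm_smul, Real.norm_of_nonneg (noiseKernel_nonneg hq _ _)]
    _ ≤ ∑ y, 2 * T * s * (∑ i, ‖(1 / 2 : ℝ) • (f y - f (flipc y i))‖ ^ p) ^ (1 / p) := by
        rw [sum_comm]
        exact sum_le_sum fun y _ => hX.sum_noiseKernel_norm_le hp hp2 hT hs hqs y _
    _ = _ := by
        rw [← mul_sum]
        ring

/-- A Poincaré-type form of the theorem that Rademacher type implies Enflo type. -/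
theorem RademacherType.sum_norm_sub_average_le [CompleteSpace X] {p T : ℝ}
    (hX : RademacherType X p T) (hp : 1 ≤ p) (hp2 : p ≤ 2) (hT : 0 < T) (f : (ι → Bool) → X) :
    ∑ x, ‖f x - (2 ^ Fintype.card ι : ℝ)⁻¹ • ∑ y, f y‖ ≤
      Real.pi * T * ∑ y, (∑ i, ‖(1 / 2 : ℝ) • (f y - f (flipc y i))‖ ^ p) ^ (1 / p) := by
  set B := ∑ y, (∑ i, ‖(1 / 2 : ℝ) • (f y - f (flipc y i))‖ ^ p) ^ (1 / p) with hB
  set R' : (ι → Bool) → ℝ → X := fun x θ =>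
    Real.cos θ • ∑ y, (∑ i, noiseKernelDeriv (Real.sin θ) x y i) • f y with hR'
  have hcont : ∀ x, Continuous (R' x) := by
    intro x
    refine Real.continuous_cos.smul (continuous_finsetSum _ fun y _ => Continuous.smul
      (continuous_finsetSum _ fun i _ => ?_) continuous_const)
    exact (continuous_noiseKernelDeriv x y i).comp Real.continuous_sin
  have hderiv : ∀ x θ, HasDerivAt (fun θ => ∑ y, noiseKernel (Real.sin θ) x y • f y) (R' x θ) θ := by
    intro x θ
    have h : R' x θ = ∑ y, ((∑ i, noiseKernelDeriv (Real.sin θ) x y i) * Real.cos θ) • f y := by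
      simp only [hR', smul_sum, smul_smul, mul_comm]
    rw [h]
    exact HasDerivAt.fun_sum fun y _ =>
      ((hasDerivAt_noiseKernel _ x y).comp θ (Real.hasDerivAt_sin θ)).smul_const (f y)
  have hpi : (0 : ℝ) ≤ Real.pi / 2 := by positivity
  have hint : ∀ x, f x - (2 ^ Fintype.card ι : ℝ)⁻¹ • ∑ y, f y = ∫ θ in 0..Real.pi / 2, R' x θ := by
    intro x
    rw [intervalIntegral.integral_eq_sub_of_hasDerivAt (fun θ _ => hderiv x θ)
      ((hcont x).intervalIntegrable _ _)]
    simp [noiseKernel_one, noiseKernel_zero, smul_sum]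
  calc ∑ x, ‖f x - (2 ^ Fintype.card ι : ℝ)⁻¹ • ∑ y, f y‖
      ≤ ∑ x, ∫ θ in 0..Real.pi / 2, ‖R' x θ‖ := by
        refine sum_le_sum fun x _ => ?_
        rw [hint]
        exact intervalIntegral.norm_integral_le_integral_norm hpi
    _ = ∫ θ in 0..Real.pi / 2, ∑ x, ‖R' x θ‖ := by
        rw [intervalIntegral.integral_finsetSum]
        exact fun x _ => (hcont x).norm.intervalIntegrable _ _
    _ ≤ ∫ _θ in 0..Real.pi / 2, 2 * T * B := by
        refine intervalIntegral.integral_mono_on hpi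
          ((continuous_finsetSum _ fun x _ => (hcont x).norm).intervalIntegrable _ _)
          (continuous_const.intervalIntegrable _ _) fun θ hθ => ?_
        refine hX.sum_norm_noise_deriv_le hp hp2 hT
          (Real.cos_nonneg_of_mem_Icc ⟨by linarith [hθ.1], hθ.2⟩) (Real.sin_sq_add_cos_sq θ) f
    _ = _ := by
        rw [intervalIntegral.integral_const, smul_eq_mul]
        ring

theorem RademacherType.average_norm_sub_average_le [CompleteSpace X] {p T : ℝ}
    (hX : RademacherType X p T) (hp : 1 ≤ p) (hp2 : p ≤ 2) (hT : 0 < T) (f : (ι → Bool) → X) :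
    (2 ^ Fintype.card ι : ℝ)⁻¹ * ∑ x, ‖f x - (2 ^ Fintype.card ι : ℝ)⁻¹ • ∑ y, f y‖ ≤
      Real.pi * T * ((2 ^ Fintype.card ι : ℝ)⁻¹ *
        ∑ y, ∑ i, ‖(1 / 2 : ℝ) • (f y - f (flipc y i))‖ ^ p) ^ (1 / p) := by
  have hp0 : 0 < p := by linarith
  have hJ := Real.arith_mean_le_rpow_mean univ (fun _ : ι → Bool => (2 ^ Fintype.card ι : ℝ)⁻¹)
    (fun y => (∑ i, ‖(1 / 2 : ℝ) • (f y - f (flipc y i))‖ ^ p) ^ (1 / p))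
    (fun _ _ => by positivity) (by simp) (fun _ _ => by positivity) hp
  have h : ∀ y, ((∑ i, ‖(1 / 2 : ℝ) • (f y - f (flipc y i))‖ ^ p) ^ (1 / p)) ^ p =
      ∑ i, ‖(1 / 2 : ℝ) • (f y - f (flipc y i))‖ ^ p := by
    intro y
    rw [← Real.rpow_mul (by positivity), one_div_mul_cancel hp0.ne', Real.rpow_one]
  simp only [h, ← mul_sum] at hJ
  calc _ ≤ (2 ^ Fintype.card ι : ℝ)⁻¹ * (Real.pi * T *
        ∑ y, (∑ i, ‖(1 / 2 : ℝ) • (f y - f (flipc y i))‖ ^ p) ^ (1 / p)) :=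
        mul_le_mul_of_nonneg_left (hX.sum_norm_sub_average_le hp hp2 hT f) (by positivity)
    _ = Real.pi * T * ((2 ^ Fintype.card ι : ℝ)⁻¹ *
        ∑ y, (∑ i, ‖(1 / 2 : ℝ) • (f y - f (flipc y i))‖ ^ p) ^ (1 / p)) := by ring
    _ ≤ _ := mul_le_mul_of_nonneg_left hJ (by positivity)

end NoiseSemigroup

section RandomSampling

lemma sum_average_block {n r : ℕ} (φ : Fin n × (Fin r → Bool) → ℝ) :
    (2 ^ Fintype.card (Fin n × Fin r) : ℝ)⁻¹ *
        ∑ b : Fin n × Fin r → Bool, ∑ i, φ (i, fun j => b (i, j)) =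
      (2 ^ r : ℝ)⁻¹ * ∑ x, φ x := by
  rw [sum_comm, mul_sum, Fintype.sum_prod_type, mul_sum]
  refine sum_congr rfl fun i _ => ?_
  have h := sum_prod_weight_mul (fun (_ : Fin n) (_ : Fin r → Bool) => (2 ^ r : ℝ)⁻¹) (by simp) i
    fun β => φ (i, β)
  rw [mul_sum, mul_sum, ← h, ← Equiv.sum_comp (Equiv.curry (Fin n) (Fin r) Bool)]
  refine sum_congr rfl fun b _ => ?_
  simp only [prod_const, card_univ, Fintype.card_prod, Fintype.card_fin, inv_pow, ← pow_mul,
    Nat.mul_comm r n]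
  rfl

/-- Enumeration of `n` consecutive blocks of `2 ^ r` cells, each indexed by binary digits. -/
def cellEquiv (n r : ℕ) : Fin n × (Fin r → Bool) ≃ Fin (n * 2 ^ r) :=
  (Equiv.prodCongr (Equiv.refl _)
    ((Equiv.arrowCongr (Equiv.refl _) finTwoEquiv.symm).trans finFunctionFinEquiv)).trans
    finProdFinEquiv

/-- The position of a cell in the enumeration `cellEquiv`. -/
def cell {n r : ℕ} (x : Fin n × (Fin r → Bool)) : ℕ := cellEquiv n r x

lemma cell_injective {n r : ℕ} : Function.Injective (cell : Fin n × (Fin r → Bool) → ℕ) :=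
  Fin.val_injective.comp (cellEquiv n r).injective

lemma cell_lt {n r : ℕ} (x : Fin n × (Fin r → Bool)) : cell x < n * 2 ^ r := (cellEquiv n r x).2

lemma cell_eq {n r : ℕ} (i : Fin n) (β : Fin r → Bool) :
    cell (i, β) = ∑ j, (β j).toNat * 2 ^ (j : ℕ) + 2 ^ r * i := by
  simp only [cell, cellEquiv, Equiv.trans_apply, Equiv.prodCongr_apply, Prod.map,
    finProdFinEquiv_apply_val, finFunctionFinEquiv_apply]
  congr 2
  funext j
  simp only [Equiv.arrowCongr_apply, Function.comp, Equiv.refl_symm, Equiv.refl_apply]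
  cases β j <;> rfl

lemma cell_flipc {n r : ℕ} (i : Fin n) (β : Fin r → Bool) (j : Fin r) :
    cell (i, flipc β j) ≤ cell (i, β) + 2 ^ (j : ℕ) ∧
      cell (i, β) ≤ cell (i, flipc β j) + 2 ^ (j : ℕ) := by
  rw [cell_eq, cell_eq, ← add_sum_erase _ _ (mem_univ j),
    ← add_sum_erase univ (fun k => (β k).toNat * 2 ^ (k : ℕ)) (mem_univ j)]
  have h : ∑ k ∈ univ.erase j, (flipc β j k).toNat * 2 ^ (k : ℕ) =
      ∑ k ∈ univ.erase j, (β k).toNat * 2 ^ (k : ℕ) := by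
    refine sum_congr rfl fun k hk => ?_
    rw [flipc, Function.update_of_ne (mem_erase.1 hk).1]
  have hj : flipc β j j = !(β j) := by simp [flipc]
  rw [h, hj]
  have hpos : 0 < 2 ^ (j : ℕ) := by positivity
  cases β j <;> simp <;> omega

/-- The indicator function modulo two of the half line starting at `N`. -/
def cut (N q : ℕ) : ZMod 2 := if N ≤ q then 1 else 0

lemma cut_succ_sub_cut (N q : ℕ) : (cut (N + 1) - cut N) q = if q = N then 1 else 0 := by
  simp only [Pi.sub_apply, cut]
  rcases lt_trichotomy q N with h | rfl | h
  · simp [show ¬N + 1 ≤ q by omega, show ¬N ≤ q by omega, show q ≠ N by omega]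
  · simp
  · simp [show N + 1 ≤ q by omega, show N ≤ q by omega, show q ≠ N by omega]

lemma cut_zero_sub_cut {L q : ℕ} (h : q < L) : (cut 0 - cut L) q = 1 := by
  simp [cut, h]

lemma sum_cut_ne_le {n r : ℕ} (j : Fin r) (N : ℕ) :
    ∑ x : Fin n × (Fin r → Bool),
        (if cut N (cell x) ≠ cut N (cell (x.1, flipc x.2 j)) then (1 : ℝ) else 0) ≤
      2 * 2 ^ (j : ℕ) := by
  rw [sum_boole]
  have h : (univ.filter fun x : Fin n × (Fin r → Bool) =>
      cut N (cell x) ≠ cut N (cell (x.1, flipc x.2 j))).card ≤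
      (Ico (N - 2 ^ (j : ℕ)) (N + 2 ^ (j : ℕ))).card := by
    refine card_le_card_of_injOn cell (fun x hx => ?_) cell_injective.injOn
    have hx' : cut N (cell x) ≠ cut N (cell (x.1, flipc x.2 j)) := by simpa using hx
    have h1 : cell (x.1, flipc x.2 j) ≤ cell x + 2 ^ (j : ℕ) ∧
      cell x ≤ cell (x.1, flipc x.2 j) + 2 ^ (j : ℕ) := cell_flipc x.1 x.2 j
    simp only [cut] at hx'
    simp only [coe_Ico, Set.mem_Ico]
    split_ifs at hx' <;> first | exact absurd rfl hx' | omega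
  rw [Nat.card_Ico] at h
  have h2 : (univ.filter fun x : Fin n × (Fin r → Bool) =>
      cut N (cell x) ≠ cut N (cell (x.1, flipc x.2 j))).card ≤ 2 * 2 ^ (j : ℕ) := by omega
  exact_mod_cast h2

lemma sum_cuts_ne_le {n r : ℕ} (j : Fin r) (l : List ℕ) :
    ∑ x : Fin n × (Fin r → Bool),
        (if (l.map cut).sum (cell x) ≠ (l.map cut).sum (cell (x.1, flipc x.2 j))
          then (1 : ℝ) else 0) ≤
      l.length * (2 * 2 ^ (j : ℕ)) := by
  induction l with
  | nil => simp
  | cons N l ih =>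
    refine (sum_le_sum (g := fun x : Fin n × (Fin r → Bool) =>
      (if cut N (cell x) ≠ cut N (cell (x.1, flipc x.2 j)) then (1 : ℝ) else 0) +
        (if (l.map cut).sum (cell x) ≠ (l.map cut).sum (cell (x.1, flipc x.2 j))
          then (1 : ℝ) else 0)) fun x _ => ?_).trans ?_
    · simp only [List.map_cons, List.sum_cons, Pi.add_apply]
      by_cases h1 : cut N (cell x) = cut N (cell (x.1, flipc x.2 j))
      · simp [h1]
      · rw [if_pos h1]
        split_ifs <;> norm_num
    · rw [sum_add_distrib]
      have := sum_cut_ne_le (n := n) j N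
      push_cast [List.length_cons]
      linarith

/-- The point of the cube whose coordinates are the values of `v` at the cells selected by `b`. -/
def samplePoint {n r : ℕ} (v : ℕ → ZMod 2) (b : Fin n × Fin r → Bool) : Fin n → Bool :=
  fun i => decide (v (cell (i, fun j => b (i, j))) = 1)

lemma samplePoint_add_of_one {n r : ℕ} (v w : ℕ → ZMod 2) (b : Fin n × Fin r → Bool)
    (hw : ∀ q < n * 2 ^ r, w q = 1) : samplePoint (v + w) b = negc (samplePoint v b) := by
  funext i
  simp only [samplePoint, negc, Pi.add_apply, hw _ (cell_lt _)]
  generalize v _ = a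
  revert a
  decide

lemma samplePoint_flipc {n r : ℕ} (v : ℕ → ZMod 2) (b : Fin n × Fin r → Bool) (i : Fin n)
    (j : Fin r) :
    samplePoint v (flipc b (i, j)) =
      if v (cell (i, fun k => b (i, k))) ≠ v (cell (i, flipc (fun k => b (i, k)) j)) then
        flipc (samplePoint v b) i else samplePoint v b := by
  have hi : (fun k => flipc b (i, j) (i, k)) = flipc (fun k => b (i, k)) j := by
    funext k
    by_cases h : k = j
    · subst h; simp [flipc]
    · simp [flipc, h]
  have hne : ∀ i', i' ≠ i → (fun k => flipc b (i, j) (i', k)) = fun k => b (i', k) := by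
    intro i' h
    funext k
    simp [flipc, h]
  have key : ∀ a c : ZMod 2, a ≠ c → decide (c = 1) = !decide (a = 1) := by decide
  funext i'
  by_cases h : i' = i
  · subst h
    change decide (v (cell (i', fun k => flipc b (i', j) (i', k))) = 1) = _
    rw [hi]
    split_ifs with h1
    · exact (key _ _ h1).trans
        (Function.update_self (β := fun _ => Bool) i' _ (samplePoint v b)).symm
    · rw [← not_not.1 h1]
      rfl
  · change decide (v (cell (i', fun k => flipc b (i, j) (i', k))) = 1) = _
    rw [hne i' h]
    split_ifs
    · rw [flipc, Function.update_of_ne h]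
      rfl
    · rfl

variable {X : Type*} [NormedAddCommGroup X] [NormedSpace ℝ X]

/-- The average of `g` over the random points `samplePoint v b`. -/
def sampleAverage {n : ℕ} (r : ℕ) (g : (Fin n → Bool) → X) (v : ℕ → ZMod 2) : X :=
  (2 ^ Fintype.card (Fin n × Fin r) : ℝ)⁻¹ • ∑ b : Fin n × Fin r → Bool, g (samplePoint v b)

lemma sampleAverage_add_of_one {n : ℕ} (r : ℕ) (g : (Fin n → Bool) → X)
    (hg : ∀ x, g (negc x) = -g x) (v w : ℕ → ZMod 2) (hw : ∀ q < n * 2 ^ r, w q = 1) :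
    sampleAverage r g (v + w) = -sampleAverage r g v := by
  simp only [sampleAverage, samplePoint_add_of_one v w _ hw, hg, sum_neg_distrib, smul_neg]

lemma norm_sampleAverage_step_le {n : ℕ} (r : ℕ) (g : (Fin n → Bool) → X) (K : ℝ)
    (hK : ∀ x, ‖g x‖ ≤ K) (v : ℕ → ZMod 2) (N : ℕ) :
    ‖sampleAverage r g (v + (cut (N + 1) - cut N)) - sampleAverage r g v‖ ≤
      2 * K * (2 ^ r : ℝ)⁻¹ := by
  have hK0 : 0 ≤ K := (norm_nonneg _).trans (hK fun _ => true)
  rw [sampleAverage, sampleAverage, ← smul_sub, ← sum_sub_distrib, norm_smul,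
    Real.norm_of_nonneg (by positivity)]
  have hcell : ∑ x : Fin n × (Fin r → Bool), (if cell x = N then (1 : ℝ) else 0) ≤ 1 := by
    rw [sum_boole]
    have : (univ.filter fun x : Fin n × (Fin r → Bool) => cell x = N).card ≤ 1 := by
      refine card_le_one.2 fun x hx y hy => cell_injective ?_
      rw [(mem_filter.1 hx).2, (mem_filter.1 hy).2]
    exact_mod_cast this
  calc (2 ^ Fintype.card (Fin n × Fin r) : ℝ)⁻¹ * ‖∑ b : Fin n × Fin r → Bool,
        (g (samplePoint (v + (cut (N + 1) - cut N)) b) - g (samplePoint v b))‖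
      ≤ (2 ^ Fintype.card (Fin n × Fin r) : ℝ)⁻¹ * ∑ b : Fin n × Fin r → Bool, ∑ i : Fin n,
          2 * K * (if cell (i, fun j => b (i, j)) = N then 1 else 0) := by
        refine mul_le_mul_of_nonneg_left ((norm_sum_le _ _).trans
          (sum_le_sum fun b _ => ?_)) (by positivity)
        by_cases h : ∃ i : Fin n, cell (i, fun j => b (i, j)) = N
        · obtain ⟨i, hi⟩ := h
          refine le_trans ?_ (single_le_sum (fun i _ => ?_) (mem_univ i))
          · rw [if_pos hi]
            linarith [norm_sub_le (g (samplePoint (v + (cut (N + 1) - cut N)) b))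
              (g (samplePoint v b)), hK (samplePoint (v + (cut (N + 1) - cut N)) b),
              hK (samplePoint v b)]
          · positivity
        · push Not at h
          have : samplePoint (v + (cut (N + 1) - cut N)) b = samplePoint v b := by
            funext i
            simp [samplePoint, -Pi.sub_apply, cut_succ_sub_cut, h i]
          rw [this, sub_self, norm_zero]
          positivity
    _ = (2 ^ r : ℝ)⁻¹ * (2 * K * ∑ x : Fin n × (Fin r → Bool), if cell x = N then 1 else 0) := by
        rw [sum_average_block fun x => 2 * K * (if cell x = N then 1 else 0), ← mul_sum]
    _ ≤ (2 ^ r : ℝ)⁻¹ * (2 * K * 1) := by gcongr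
    _ = _ := by ring

lemma average_sum_norm_samplePoint_le {n r : ℕ} {p M : ℝ} (hp : 0 < p) (hM : 0 ≤ M)
    (g : (Fin n → Bool) → X) (hg : ∀ x i, ‖g x - g (flipc x i)‖ ≤ 2 * M) (l : List ℕ) :
    (2 ^ Fintype.card (Fin n × Fin r) : ℝ)⁻¹ * ∑ b : Fin n × Fin r → Bool, ∑ k,
        ‖(1 / 2 : ℝ) • (g (samplePoint (l.map cut).sum b) -
          g (samplePoint (l.map cut).sum (flipc b k)))‖ ^ p ≤
      2 * l.length * M ^ p := by
  set v := (l.map cut).sum with hv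
  have hterm : ∀ (b : Fin n × Fin r → Bool) (i : Fin n) (j : Fin r),
      ‖(1 / 2 : ℝ) • (g (samplePoint v b) - g (samplePoint v (flipc b (i, j))))‖ ^ p ≤
        M ^ p * (if v (cell (i, fun k => b (i, k))) ≠ v (cell (i, flipc (fun k => b (i, k)) j))
          then 1 else 0) := by
    intro b i j
    rw [samplePoint_flipc]
    split_ifs
    · rw [mul_one]
      refine Real.rpow_le_rpow (norm_nonneg _) ?_ hp.le
      rw [norm_smul, Real.norm_of_nonneg (by norm_num)]
      linarith [hg (samplePoint v b) i]
    · simp [hp.ne']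
  have hgeom : ∑ j : Fin r, (2 : ℝ) ^ (j : ℕ) ≤ 2 ^ r := by
    rw [Fin.sum_univ_eq_sum_range (fun j => (2 : ℝ) ^ j), geom_sum_eq (by norm_num)]
    norm_num
  have hMp : 0 ≤ M ^ p := by positivity
  calc _ ≤ (2 ^ Fintype.card (Fin n × Fin r) : ℝ)⁻¹ * ∑ b : Fin n × Fin r → Bool, ∑ i : Fin n,
          ∑ j : Fin r, M ^ p * (if v (cell (i, fun k => b (i, k))) ≠
            v (cell (i, flipc (fun k => b (i, k)) j)) then 1 else 0) := by
        gcongr with b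
        rw [Fintype.sum_prod_type]
        exact sum_le_sum fun i _ => sum_le_sum fun j _ => hterm b i j
    _ = (2 ^ r : ℝ)⁻¹ * ∑ j : Fin r, M ^ p * ∑ x : Fin n × (Fin r → Bool),
          (if v (cell x) ≠ v (cell (x.1, flipc x.2 j)) then 1 else 0) := by
        rw [sum_average_block fun x => ∑ j : Fin r, M ^ p *
          (if v (cell x) ≠ v (cell (x.1, flipc x.2 j)) then 1 else 0), sum_comm]
        simp only [mul_sum]
    _ ≤ (2 ^ r : ℝ)⁻¹ * ∑ j : Fin r, M ^ p * (l.length * (2 * 2 ^ (j : ℕ))) := by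
        gcongr with j
        exact sum_cuts_ne_le j l
    _ = (2 ^ r : ℝ)⁻¹ * (∑ j : Fin r, (2 : ℝ) ^ (j : ℕ)) * (2 * l.length * M ^ p) := by
        rw [mul_sum, mul_sum, sum_mul]
        exact sum_congr rfl fun j _ => by ring
    _ ≤ (2 ^ r : ℝ)⁻¹ * 2 ^ r * (2 * l.length * M ^ p) := by gcongr
    _ = _ := by rw [inv_mul_cancel₀ (by positivity), one_mul]

lemma exists_cuts_norm_sampleAverage_le [FiniteDimensional ℝ X] {n : ℕ} (hn : 0 < n)
    (g : (Fin n → Bool) → X) (hg : ∀ x, g (negc x) = -g x) :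
    ∃ A : ℝ, 0 ≤ A ∧ ∀ r : ℕ, ∃ l : List ℕ, l.length = Module.finrank ℝ X ∧
      ‖sampleAverage r g (l.map cut).sum‖ ≤ A * (2 ^ r : ℝ)⁻¹ := by
  set d := Module.finrank ℝ X with hd
  set e := Module.finBasis ℝ X with he
  set φ : Fin d → X →L[ℝ] ℝ := fun i => LinearMap.toContinuousLinearMap (e.coord i) with hφ
  set K := ∑ x, ‖g x‖ with hK
  have hKx : ∀ x, ‖g x‖ ≤ K := fun x =>
    single_le_sum (f := fun x => ‖g x‖) (fun _ _ => norm_nonneg _) (mem_univ x)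
  have hK0 : 0 ≤ K := sum_nonneg fun _ _ => norm_nonneg _
  set Φ := ∑ i, ‖φ i‖ with hΦ
  have hΦ0 : 0 ≤ Φ := sum_nonneg fun _ _ => norm_nonneg _
  refine ⟨(d + 1) * (Φ * (2 * K)) * ∑ i, ‖e i‖, by positivity, fun r => ?_⟩
  obtain ⟨l, hl, hbound⟩ := exists_cuts_abs_le cut (n * 2 ^ r)
    (fun N => by funext q; exact CharTwo.add_self_eq_zero ((cut (N + 1) - cut N) q)) (fun v => v 0)
    (fun v => by rw [Pi.add_apply, cut_zero_sub_cut (by positivity)])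
    (fun i v => φ i (sampleAverage r g v))
    (fun i v => by
      rw [sampleAverage_add_of_one r g hg v _ fun q hq => cut_zero_sub_cut hq, map_neg])
    (Φ * (2 * K * (2 ^ r : ℝ)⁻¹)) (by positivity)
    (fun i v N _ => by
      rw [← map_sub, ← Real.norm_eq_abs]
      refine (φ i).le_of_opNorm_le_of_le ?_ (norm_sampleAverage_step_le r g K hKx v N)
      exact single_le_sum (f := fun i => ‖φ i‖) (fun _ _ => norm_nonneg _) (mem_univ i))
  refine ⟨l, hl, ?_⟩
  rw [← e.sum_repr (sampleAverage r g (l.map cut).sum)]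
  calc _ ≤ ∑ i, (d + 1) * (Φ * (2 * K * (2 ^ r : ℝ)⁻¹)) * ‖e i‖ := by
        refine (norm_sum_le _ _).trans (sum_le_sum fun i _ => ?_)
        rw [norm_smul]
        exact mul_le_mul_of_nonneg_right (hbound i) (norm_nonneg _)
    _ = _ := by
        rw [← mul_sum]
        ring

/-- If the sampled values of `g` average to something small, then some value of `g` is small. -/
lemma exists_norm_le_of_cuts [CompleteSpace X] {p T : ℝ} (hX : RademacherType X p T) (hp : 1 ≤ p)
    (hp2 : p ≤ 2) (hT : 0 < T) {n : ℕ} {M : ℝ} (hM : 0 ≤ M) (g : (Fin n → Bool) → X)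
    (hg : ∀ x i, ‖g x - g (flipc x i)‖ ≤ 2 * M) (r : ℕ) (l : List ℕ) :
    ∃ x, ‖g x‖ ≤ 8 * T * (l.length : ℝ) ^ (1 / p) * M + ‖sampleAverage r g (l.map cut).sum‖ := by
  have hp0 : 0 < p := by linarith
  set v := (l.map cut).sum with hv
  have h1 := hX.average_norm_sub_average_le hp hp2 hT
    fun b : Fin n × Fin r → Bool => g (samplePoint v b)
  have h2 := average_sum_norm_samplePoint_le (r := r) hp0 hM g hg l
  have h3 : Real.pi * T * (2 * l.length * M ^ p) ^ (1 / p) ≤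
      8 * T * (l.length : ℝ) ^ (1 / p) * M := by
    rw [Real.mul_rpow (by positivity) (by positivity), Real.mul_rpow (by positivity) (by positivity),
      ← Real.rpow_mul hM, mul_one_div_cancel hp0.ne', Real.rpow_one]
    have h4 : (2 : ℝ) ^ (1 / p) ≤ 2 := by
      conv_rhs => rw [← Real.rpow_one 2]
      exact Real.rpow_le_rpow_of_exponent_le one_le_two ((div_le_one hp0).2 hp)
    have h5 : Real.pi * (2 : ℝ) ^ (1 / p) ≤ 4 * 2 :=
      mul_le_mul Real.pi_le_four h4 (by positivity) (by norm_num)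
    calc _ = Real.pi * (2 : ℝ) ^ (1 / p) * (T * (l.length : ℝ) ^ (1 / p) * M) := by ring
      _ ≤ 4 * 2 * (T * (l.length : ℝ) ^ (1 / p) * M) := by gcongr
      _ = _ := by ring
  have h6 : (2 ^ Fintype.card (Fin n × Fin r) : ℝ)⁻¹ *
      ∑ b : Fin n × Fin r → Bool, ‖g (samplePoint v b) - sampleAverage r g v‖ ≤
        8 * T * (l.length : ℝ) ^ (1 / p) * M := by
    refine h1.trans (le_trans ?_ h3)
    gcongr
  by_contra! hlt
  have h7 : ∀ b : Fin n × Fin r → Bool, 8 * T * (l.length : ℝ) ^ (1 / p) * M <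
      ‖g (samplePoint v b) - sampleAverage r g v‖ := by
    intro b
    linarith [hlt (samplePoint v b), norm_sub_norm_le (g (samplePoint v b)) (sampleAverage r g v)]
  have h8 := sum_lt_sum_of_nonempty (univ_nonempty (α := Fin n × Fin r → Bool)) fun b _ => h7 b
  rw [sum_const, nsmul_eq_mul, card_univ, Fintype.card_fun, Fintype.card_bool] at h8
  rw [inv_mul_le_iff₀ (by positivity)] at h6
  push_cast at h8
  linarith

end RandomSampling

lemma negc_negc {ι : Type*} (x : ι → Bool) : negc (negc x) = x := by
  funext i
  simp [negc]

lemma negc_flipc {ι : Type*} [DecidableEq ι] (x : ι → Bool) (i : ι) :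
    negc (flipc x i) = flipc (negc x) i := by
  funext k
  by_cases h : k = i
  · subst h; simp [negc, flipc]
  · simp [negc, flipc, h]


/-- There is a universal constant `C` such that for every function on
`{-1,1}^n` with values in a `d`-dimensional normed space of Rademacher type `p`
(`d < n`), some antipodal pair is mapped at distance at most `C·T·d^{1/p}` times any
upper bound `M` on the displacement of the edges of the cube. -/
theorem stmt15 :
    ∃ C : ℝ, 0 < C ∧
      ∀ (p : ℝ), 1 ≤ p → p ≤ 2 →
      ∀ (X : Type) [NormedAddCommGroup X] [NormedSpace ℝ X] [FiniteDimensional ℝ X],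
      ∀ T : ℝ, 0 < T → RademacherType X p T →
      ∀ n : ℕ, Module.finrank ℝ X < n →
      ∀ (f : (Fin n → Bool) → X) (M : ℝ),
      (∀ (x : Fin n → Bool) (i : Fin n), ‖f x - f (flipc x i)‖ ≤ M) →
      ∃ x : Fin n → Bool,
        ‖f x - f (negc x)‖ ≤ C * T * ((Module.finrank ℝ X : ℝ) ^ (1 / p)) * M := by
  refine ⟨8, by norm_num, ?_⟩
  intro p hp hp2 X _ _ _ T hT hX n hn f M hf
  have hn0 : 0 < n := by omega
  have hM : 0 ≤ M := (norm_nonneg _).trans (hf (fun _ => true) ⟨0, hn0⟩)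
  have : CompleteSpace X := FiniteDimensional.complete ℝ X
  set g : (Fin n → Bool) → X := fun x => f x - f (negc x) with hg
  have hodd : ∀ x, g (negc x) = -g x := fun x => by simp only [hg, negc_negc, neg_sub]
  have hedge : ∀ x i, ‖g x - g (flipc x i)‖ ≤ 2 * M := by
    intro x i
    have h : g x - g (flipc x i) =
        (f x - f (flipc x i)) - (f (negc x) - f (flipc (negc x) i)) := by
      simp only [hg, negc_flipc]
      abel
    rw [h]
    linarith [norm_sub_le (f x - f (flipc x i)) (f (negc x) - f (flipc (negc x) i)), hf x i,
      hf (negc x) i]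
  obtain ⟨A, hA, hcuts⟩ := exists_cuts_norm_sampleAverage_le hn0 g hodd
  obtain ⟨x₀, -, hx₀⟩ := exists_min_image univ (fun x => ‖g x‖) univ_nonempty
  refine ⟨x₀, le_of_forall_pos_le_add fun ε hε => ?_⟩
  obtain ⟨r, hr⟩ := exists_pow_lt_of_lt_one (show 0 < ε / (A + 1) by positivity)
    (show (2 : ℝ)⁻¹ < 1 by norm_num)
  obtain ⟨l, hl, hsmall⟩ := hcuts r
  obtain ⟨x, hx⟩ := exists_norm_le_of_cuts hX hp hp2 hT hM g hedge r l
  rw [hl] at hx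
  rw [inv_pow, lt_div_iff₀ (by positivity)] at hr
  have hpow : (0 : ℝ) < (2 ^ r)⁻¹ := by positivity
  calc ‖f x₀ - f (negc x₀)‖ ≤ ‖g x‖ := hx₀ x (mem_univ x)
    _ ≤ _ := hx
    _ ≤ _ := by nlinarith
end
end

section
/- Fix n ∈ ℕ and 𝛂 = (α_1,…,α_n) ∈ (0,1)^n, let X be a real normed space, let f : {-1,1}^n → X, and fix x ∈ {-1,1}^n. Then the map t ↦ Σ_{y ∈ {-1,1}^n} p_t^𝛂(x,y) f(y) (defined for all real t by the explicit kernel formula) has derivative at t = 0 equal to −Σ_{i=1}^n ∂_i^{α_i} f(x). -/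
open Finset

noncomputable section

theorem ptrans_zero (α : ℝ) (b c : Bool) : ptrans 0 α b c = if b = c then 1 else 0 := by
  cases b <;> cases c <;> simp [ptrans]

/-- The time derivative at `0` of the one-dimensional transition kernel. -/
def ptransDeriv (α : ℝ) (b c : Bool) : ℝ :=
  (if c then α else 1 - α) - if b = c then 1 else 0

theorem hasDerivAt_ptrans (α : ℝ) (b c : Bool) :
    HasDerivAt (fun t => ptrans t α b c) (ptransDeriv α b c) 0 := by
  have h : HasDerivAt (fun t : ℝ => 1 - Real.exp (-t)) 1 0 := by
    simpa using ((hasDerivAt_neg (0 : ℝ)).exp).const_sub 1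
  cases b <;> cases c <;> simp only [ptrans, ptransDeriv]
  · simpa using (h.mul_const α).const_sub 1
  · simpa using h.mul_const α
  · simpa using h.mul_const (1 - α)
  · simpa using (h.mul_const (1 - α)).const_sub 1

theorem hasDerivAt_pprod {n : ℕ} (a : Fin n → ℝ) (x y : Fin n → Bool) :
    HasDerivAt (fun t => pprod t a x y)
      (∑ i, (∏ j ∈ univ.erase i, if x j = y j then (1 : ℝ) else 0) *
        ptransDeriv (a i) (x i) (y i)) 0 := by
  simpa only [pprod, ptrans_zero, smul_eq_mul] using
    HasDerivAt.fun_finsetProd (u := univ) fun i _ => hasDerivAt_ptrans (a i) (x i) (y i)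

theorem sum_prod_erase_smul {ι X : Type*} [Fintype ι] [DecidableEq ι] [AddCommGroup X]
    [Module ℝ X] (i : ι) (x : ι → Bool) (g : (ι → Bool) → X) :
    ∑ y : ι → Bool, (∏ j ∈ univ.erase i, if x j = y j then (1 : ℝ) else 0) • g y =
      ∑ b : Bool, g (Function.update x i b) := by
  symm
  apply sum_of_injOn (Function.update x i) ((Function.update_injective x i).injOn) (by simp)
  · intro y _ hy
    obtain ⟨j, hj, hne⟩ : ∃ j, j ≠ i ∧ x j ≠ y j := by
      by_contra! h
      refine hy ⟨y i, by simp, ?_⟩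
      ext j
      by_cases hj : j = i
      · subst hj; simp
      · simp [hj, h j hj]
    rw [prod_eq_zero (mem_erase.2 ⟨hj, mem_univ j⟩) (if_neg hne), zero_smul]
  · intro b _
    rw [prod_eq_one, one_smul]
    intro j hj
    simp [(mem_erase.1 hj).1]

theorem sum_ptransDeriv_smul_update {ι X : Type*} [DecidableEq ι] [AddCommGroup X]
    [Module ℝ X] (α : ℝ) (i : ι) (f : (ι → Bool) → X) (x : ι → Bool) :
    ∑ b : Bool, ptransDeriv α (x i) b • f (Function.update x i b) = -bder α i f x := by
  have hx : f x = f (Function.update x i (x i)) := by rw [Function.update_eq_self]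
  rw [bder, hx]
  cases x i <;> simp [ptransDeriv] <;> module

/-- The generator of the biased semigroup: the derivative at `t = 0`
of `t ↦ Σ_y p_t^𝛂(x,y) f(y)` equals `-Σ_i ∂_i^{α_i} f(x)`. -/
theorem stmt18 (n : ℕ) (a : Fin n → ℝ) (ha : ∀ i, 0 < a i ∧ a i < 1)
    (X : Type) [NormedAddCommGroup X] [NormedSpace ℝ X]
    (f : (Fin n → Bool) → X) (x : Fin n → Bool) :
    HasDerivAt (fun t : ℝ => ∑ y : Fin n → Bool, pprod t a x y • f y)
      (-∑ i, bder (a i) i f x) 0 := by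
  refine (HasDerivAt.fun_sum fun y _ => (hasDerivAt_pprod a x y).smul_const (f y)).congr_deriv ?_
  simp_rw [sum_smul, mul_smul]
  rw [sum_comm, ← sum_neg_distrib]
  refine sum_congr rfl fun i _ => ?_
  rw [sum_prod_erase_smul i x fun y => ptransDeriv (a i) (x i) (y i) • f y]
  simpa using sum_ptransDeriv_smul_update (a i) i f x
end
end
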